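/- Let 𝐟_1, …, 𝐟_k : ℕ → ℕ^m be functions each of whose coordinates is given by a polynomial with integer coefficients. For each n, let π_n : ℕ^k → ℕ^m be the additive monoid homomorphism sending (z_1, …, z_k) to Σ_i z_i·𝐟_i(n), and let ker(π_n) be the additive congruence {(z, z') ∈ ℕ^k × ℕ^k : π_n(z) = π_n(z')}. Then the function sending n to the minimal cardinality of a finite set R ⊆ ℕ^k × ℕ^k whose generated additive congruence equals ker(π_n) (i.e., the cardinality of a minimal presentation of the affine semigroup S_n = ⟨𝐟_1(n), …, 𝐟_k(n)⟩) is eventually quasi-polynomial. -/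

import Mathlib

/-- A function `c : ℕ → ℚ` is eventually periodic if there are `N` and `p ≥ 1`
with `c (n + p) = c n` for all `n ≥ N`. -/
def EvPeriodic (c : ℕ → ℚ) : Prop :=
  ∃ N p : ℕ, 1 ≤ p ∧ ∀ n, N ≤ n → c (n + p) = c n

/-- A function `g : ℕ → ℤ` is eventually quasi-polynomial if
`g n = Σ_{i=0}^d c_i(n)·n^i` for eventually periodic `c_0, …, c_d : ℕ → ℚ`. -/
def IsEQP (g : ℕ → ℤ) : Prop :=
  ∃ (d : ℕ) (c : ℕ → ℕ → ℚ), (∀ i, i ≤ d → EvPeriodic (c i)) ∧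
    ∀ n : ℕ, (g n : ℚ) = ∑ i ∈ Finset.range (d + 1), c i n * (n : ℚ) ^ i

open Filter

/-- Along every residue class modulo some `p`, the function eventually agrees with a polynomial. -/
def IsClasswisePoly (g : ℕ → ℤ) : Prop :=
  ∃ p : ℕ, 1 ≤ p ∧ ∀ r : ℕ, ∃ P : Polynomial ℚ,
    ∀ᶠ t : ℕ in atTop, (g (p * t + r) : ℚ) = P.eval (t : ℚ)

namespace IsClasswisePoly

variable {g h : ℕ → ℤ}

theorem congr (hg : IsClasswisePoly g) (hgh : ∀ᶠ n in atTop, g n = h n) : IsClasswisePoly h := by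
  obtain ⟨p, hp, H⟩ := hg
  refine ⟨p, hp, fun r => ?_⟩
  obtain ⟨P, hP⟩ := H r
  refine ⟨P, ?_⟩
  have ht : Tendsto (fun t : ℕ => p * t + r) atTop atTop :=
    tendsto_atTop_mono (fun t => by simp only [id]; nlinarith) tendsto_id
  filter_upwards [hP, ht.eventually hgh] with t h1 h2
  rw [← h2, h1]

theorem const (c : ℤ) : IsClasswisePoly fun _ => c :=
  ⟨1, le_rfl, fun _ => ⟨Polynomial.C (c : ℚ), by simp⟩⟩

theorem exists_period_mul {p e : ℕ} (he : 1 ≤ e)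
    (H : ∀ r : ℕ, ∃ P : Polynomial ℚ, ∀ᶠ t : ℕ in atTop, (g (p * t + r) : ℚ) = P.eval (t : ℚ))
    (r : ℕ) :
    ∃ P : Polynomial ℚ, ∀ᶠ t : ℕ in atTop, (g (p * e * t + r) : ℚ) = P.eval (t : ℚ) := by
  obtain ⟨P, hP⟩ := H r
  refine ⟨P.comp (Polynomial.C (e : ℚ) * Polynomial.X), ?_⟩
  have ht : Tendsto (fun t : ℕ => e * t) atTop atTop :=
    tendsto_atTop_mono (fun t => by simp only [id]; nlinarith) tendsto_id
  filter_upwards [ht.eventually hP] with t h1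
  rw [mul_assoc, h1]
  simp

theorem add (hg : IsClasswisePoly g) (hh : IsClasswisePoly h) :
    IsClasswisePoly fun n => g n + h n := by
  obtain ⟨p, hp, H⟩ := hg
  obtain ⟨q, hq, K⟩ := hh
  refine ⟨p * q, Nat.mul_pos hp hq, fun r => ?_⟩
  obtain ⟨P, hP⟩ := exists_period_mul hq H r
  obtain ⟨Q, hQ⟩ := exists_period_mul hp K r
  refine ⟨P + Q, ?_⟩
  filter_upwards [hP, hQ] with t h1 h2
  rw [mul_comm q p] at h2
  push_cast
  rw [h1, h2, Polynomial.eval_add]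

theorem const_mul (c : ℤ) (hg : IsClasswisePoly g) : IsClasswisePoly fun n => c * g n := by
  obtain ⟨p, hp, H⟩ := hg
  refine ⟨p, hp, fun r => ?_⟩
  obtain ⟨P, hP⟩ := H r
  refine ⟨Polynomial.C (c : ℚ) * P, ?_⟩
  filter_upwards [hP] with t h1
  simp [h1]

theorem sub (hg : IsClasswisePoly g) (hh : IsClasswisePoly h) :
    IsClasswisePoly fun n => g n - h n :=
  (hg.add (hh.const_mul (-1))).congr (.of_forall fun n => by ring)

theorem sum {ι : Type*} (s : Finset ι) {f : ι → ℕ → ℤ} (hf : ∀ i ∈ s, IsClasswisePoly (f i)) :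
    IsClasswisePoly fun n => ∑ i ∈ s, f i n := by
  classical
  induction s using Finset.induction_on with
  | empty => simpa using const 0
  | insert a s ha ih =>
    simp only [Finset.sum_insert ha]
    exact (hf a (by simp)).add (ih fun i hi => hf i (by simp [hi]))

/-- Every rational polynomial has a discrete antiderivative. -/
theorem _root_.Polynomial.exists_comp_X_add_one_sub_eq (D : Polynomial ℚ) :
    ∃ Q : Polynomial ℚ, Q.comp (1 + Polynomial.X) - Q = D := by
  induction D using Polynomial.induction_on' with
  | add p q hp hq =>
    obtain ⟨P, rfl⟩ := hp
    obtain ⟨Q, rfl⟩ := hq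
    exact ⟨P + Q, by rw [Polynomial.add_comp]; ring⟩
  | monomial n a =>
    refine ⟨Polynomial.C (a / (n + 1)) * Polynomial.bernoulli (n + 1), ?_⟩
    rw [Polynomial.mul_comp, Polynomial.C_comp, Polynomial.bernoulli_comp_one_add_X, mul_add,
      add_sub_cancel_left, ← Polynomial.C_mul_X_pow_eq_monomial, nsmul_eq_mul,
      ← Polynomial.C_eq_natCast, ← mul_assoc, ← Polynomial.C_mul]
    congr 2
    have : (n : ℚ) + 1 ≠ 0 := by positivity
    push_cast
    field_simp

theorem of_sub {w : ℕ} (hw : 1 ≤ w) (hh : IsClasswisePoly h)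
    (H : ∀ᶠ n in atTop, g (n + w) - g n = h n) : IsClasswisePoly g := by
  obtain ⟨p, hp, K⟩ := hh
  refine ⟨p * w, Nat.mul_pos hp hw, fun r => ?_⟩
  choose P hP using exists_period_mul hw K
  obtain ⟨Q, hQ⟩ := (∑ j ∈ Finset.range p, P (r + j * w)).exists_comp_X_add_one_sub_eq
  have hstep : ∀ᶠ t : ℕ in atTop,
      (g (p * w * (t + 1) + r) : ℚ) - Q.eval ((t + 1 : ℕ) : ℚ)
        = g (p * w * t + r) - Q.eval (t : ℚ) := by
    have ht : ∀ j : ℕ, Tendsto (fun t : ℕ => p * w * t + r + j * w) atTop atTop := fun j =>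
      tendsto_atTop_mono (fun t => by
        have : 1 ≤ p * w := Nat.mul_pos hp hw
        simp only [id]; nlinarith) tendsto_id
    have h1 : ∀ᶠ t : ℕ in atTop, ∀ j ∈ Finset.range p,
        (h (p * w * t + (r + j * w)) : ℚ) = (P (r + j * w)).eval (t : ℚ) :=
      (Finset.eventually_all _).2 fun j _ => hP _
    have h2 : ∀ᶠ t : ℕ in atTop, ∀ j ∈ Finset.range p,
        g (p * w * t + r + j * w + w) - g (p * w * t + r + j * w) = h (p * w * t + r + j * w) :=
      (Finset.eventually_all _).2 fun j _ => (ht j).eventually H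
    filter_upwards [h1, h2] with t h1 h2
    have h3 := Finset.sum_range_sub (fun j => (g (p * w * t + r + j * w) : ℚ)) p
    have h4 : ∑ j ∈ Finset.range p, ((g (p * w * t + r + (j + 1) * w) : ℚ)
        - g (p * w * t + r + j * w)) = (Q.comp (1 + Polynomial.X) - Q).eval (t : ℚ) := by
      rw [hQ, Polynomial.eval_finsetSum]
      refine Finset.sum_congr rfl fun j hj => ?_
      rw [← h1 j hj, ← add_assoc, ← h2 j hj]
      push_cast
      ring_nf
    rw [h3] at h4
    simp only [Polynomial.eval_sub, Polynomial.eval_comp, Polynomial.eval_add,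
      Polynomial.eval_one, Polynomial.eval_X, zero_mul, add_zero] at h4
    have h5 : p * w * (t + 1) + r = p * w * t + r + p * w := by ring
    rw [h5]
    push_cast
    rw [add_comm (t : ℚ) 1]
    linarith
  obtain ⟨N, hN⟩ := eventually_atTop.1 hstep
  refine ⟨Q + Polynomial.C ((g (p * w * N + r) : ℚ) - Q.eval (N : ℚ)),
    eventually_atTop.2 ⟨N, fun t ht => ?_⟩⟩
  have : (g (p * w * t + r) : ℚ) - Q.eval (t : ℚ) = g (p * w * N + r) - Q.eval (N : ℚ) := by
    induction t, ht using Nat.le_induction with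
    | base => rfl
    | succ t ht ih => rw [hN t ht, ih]
  rw [Polynomial.eval_add, Polynomial.eval_C, ← this]
  ring

theorem isEQP (hg : IsClasswisePoly g) : IsEQP g := by
  obtain ⟨p, hp, H⟩ := hg
  choose P hP using H
  obtain ⟨N, hN⟩ := eventually_atTop.1 <|
    (Finset.eventually_all (Finset.range p)).2 fun r _ => hP r
  have hp0 : (p : ℚ) ≠ 0 := by positivity
  let Q : ℕ → Polynomial ℚ := fun r =>
    (P r).comp (Polynomial.C (1 / (p : ℚ)) * (Polynomial.X - Polynomial.C (r : ℚ)))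
  refine ⟨(Finset.range p).sup fun r => (Q r).natDegree, fun i n =>
    if n < p * N + p then (if i = 0 then (g n : ℚ) else 0) else (Q (n % p)).coeff i,
    fun i _ => ⟨p * N + p, p, hp, fun n hn => ?_⟩, fun n => ?_⟩
  · dsimp only
    rw [if_neg (by omega), if_neg (by omega), Nat.add_mod_right]
  · dsimp only
    split_ifs with hn
    · simp [Finset.sum_ite_eq']
    · have hr : n % p < p := Nat.mod_lt _ hp
      have hd : (Q (n % p)).natDegree < ((Finset.range p).sup fun r => (Q r).natDegree) + 1 :=
        Nat.lt_succ_of_le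
          (Finset.le_sup (f := fun r => (Q r).natDegree) (Finset.mem_range.2 hr))
      rw [← Polynomial.eval_eq_sum_range' hd]
      have hdiv : N ≤ n / p := by
        rw [Nat.le_div_iff_mul_le hp]
        nlinarith
      have h1 := hN (n / p) hdiv (n % p) (Finset.mem_range.2 hr)
      rw [Nat.div_add_mod] at h1
      rw [h1]
      have h2 : (n : ℚ) = p * (n / p : ℕ) + (n % p : ℕ) := by
        exact_mod_cast (Nat.div_add_mod n p).symm
      simp only [Q, Polynomial.eval_comp, Polynomial.eval_mul, Polynomial.eval_C,
        Polynomial.eval_sub, Polynomial.eval_X]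
      congr 1
      rw [h2]
      field_simp
      simp

end IsClasswisePoly

open Pointwise in
/-- A set is a finitely generated shift if it is a finite union of translates of one finitely
generated submonoid. -/
def IsFGShift {M : Type*} [AddCommMonoid M] (X : Set M) : Prop :=
  ∃ C t : Set M, C.Finite ∧ t.Finite ∧ X = C + (AddSubmonoid.closure t : Set M)

namespace IsFGShift

open Pointwise AddSubmonoid

variable {M : Type*} [AddCommMonoid M]

theorem of_isLinearSet {X : Set M} (hX : IsLinearSet X) : IsFGShift X := by
  obtain ⟨a, t, ht, rfl⟩ := hX
  exact ⟨{a}, t, Set.finite_singleton a, ht, by rw [Set.singleton_add]; rfl⟩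

theorem exists_le_minimal {α : Type*} [PartialOrder α] [WellQuasiOrderedLE α] {s : Set α} {x : α}
    (hx : x ∈ s) : ∃ y ≤ x, Minimal (· ∈ s) y := by
  have hwf : WellFounded ((· < ·) : α → α → Prop) := wellFounded_lt
  obtain ⟨y, ⟨hy, hyx⟩, hmin⟩ := hwf.has_min {y | y ∈ s ∧ y ≤ x} ⟨x, hx, le_rfl⟩
  refine ⟨y, hyx, hy, fun z hz hzy => ?_⟩
  by_contra hne
  exact hmin z ⟨hz, hzy.trans hyx⟩ (lt_of_le_not_ge hzy hne)

theorem finite_minimal {α : Type*} [PartialOrder α] [WellQuasiOrderedLE α] (s : Set α) :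
    {x | Minimal (· ∈ s) x}.Finite :=
  (setOfPred_minimal_antichain _).finite_of_partiallyWellOrderedOn
    (Set.isPWO_of_wellQuasiOrderedLE _)

/-- Noetherianity: a shift-invariant subset of a finitely generated shift is finitely generated over
the same submonoid. -/
theorem exists_finite_add_closure_eq {C t Y : Set M} (hC : C.Finite) (ht : t.Finite)
    (hY : Y ⊆ C + (closure t : Set M)) (hYt : ∀ y ∈ Y, ∀ m ∈ closure t, y + m ∈ Y) :
    ∃ C' : Set M, C'.Finite ∧ Y = C' + (closure t : Set M) := by
  obtain ⟨s, f, hf⟩ := fg_iff_exists_fin_addMonoidHom.1 ((fg_iff (closure t)).2 ⟨t, rfl, ht⟩)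
  rw [← hf] at hY hYt ⊢
  refine ⟨⋃ c ∈ C, (fun l => c + f l) '' {l | Minimal (· ∈ {l | c + f l ∈ Y}) l},
    hC.biUnion fun c _ => (finite_minimal _).image _, Set.Subset.antisymm (fun y hy => ?_) ?_⟩
  · obtain ⟨c, hc, _, ⟨l, rfl⟩, rfl⟩ := hY hy
    obtain ⟨l₀, hle, hmin⟩ := exists_le_minimal (s := {l | c + f l ∈ Y}) (x := l) hy
    refine ⟨c + f l₀, Set.mem_biUnion hc ⟨l₀, hmin, rfl⟩, f (l - l₀), ⟨_, rfl⟩, ?_⟩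
    simp only [add_assoc, ← map_add, add_tsub_cancel_of_le hle]
  · rintro _ ⟨x, hx, m, hm, rfl⟩
    simp only [Set.mem_iUnion] at hx
    obtain ⟨c, -, l, hl, rfl⟩ := hx
    exact hYt _ hl.1 _ hm

theorem inter [IsCancelAdd M] {X Y : Set M} (hX : IsFGShift X) (hY : IsFGShift Y) :
    IsFGShift (X ∩ Y) := by
  obtain ⟨C, t, hC, ht, rfl⟩ := hX
  obtain ⟨D, u, hD, hu, rfl⟩ := hY
  obtain ⟨r, f, hf⟩ := fg_iff_exists_fin_addMonoidHom.1 ((fg_iff (closure t)).2 ⟨t, rfl, ht⟩)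
  obtain ⟨s, g, hg⟩ := fg_iff_exists_fin_addMonoidHom.1 ((fg_iff (closure u)).2 ⟨u, rfl, hu⟩)
  rw [← hf, ← hg]
  let f' := f.comp (AddMonoidHom.fst (Fin r → ℕ) (Fin s → ℕ))
  let g' := g.comp (AddMonoidHom.snd (Fin r → ℕ) (Fin s → ℕ))
  obtain ⟨v, hv, hvf⟩ := (fg_iff _).1 ((fg_eqLocusM f' g').map f')
  let sol : M → M → Set ((Fin r → ℕ) × (Fin s → ℕ)) := fun c d => {x | c + f' x = d + g' x}
  refine ⟨⋃ c ∈ C, ⋃ d ∈ D, (fun x => c + f' x) '' {x | Minimal (· ∈ sol c d) x}, v,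
    hC.biUnion fun c _ => hD.biUnion fun d _ => (finite_minimal _).image _, hvf, ?_⟩
  rw [hv]
  refine Set.Subset.antisymm ?_ ?_
  · rintro _ ⟨⟨c, hc, _, ⟨l, rfl⟩, rfl⟩, ⟨d, hd, _, ⟨l', rfl⟩, h⟩⟩
    obtain ⟨⟨a, b⟩, hle, hmin⟩ :=
      exists_le_minimal (s := sol c d) (x := (l, l')) h.symm
    have hfl : f l = f a + f (l - a) := by rw [← map_add, add_tsub_cancel_of_le hle.1]
    have hgl : g l' = g b + g (l' - b) := by rw [← map_add, add_tsub_cancel_of_le hle.2]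
    refine ⟨c + f a, ?_, f (l - a), ⟨(l - a, l' - b), ?_, rfl⟩, ?_⟩
    · exact Set.mem_biUnion hc (Set.mem_biUnion hd ⟨(a, b), hmin, rfl⟩)
    · have h0 : c + f a = d + g b := hmin.1
      have h1 : d + g l' = c + f l := h
      rw [hfl, hgl, ← add_assoc, ← add_assoc, h0] at h1
      exact (add_left_cancel h1).symm
    · simp only [hfl, add_assoc]
  · rintro _ ⟨x, hx, _, ⟨⟨δ, ε⟩, hδ, rfl⟩, rfl⟩
    simp only [Set.mem_iUnion] at hx
    obtain ⟨c, hc, d, hd, ⟨a, b⟩, hab, rfl⟩ := hx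
    have h0 : c + f a = d + g b := hab.1
    have h1 : f δ = g ε := hδ
    refine ⟨⟨c, hc, f (a + δ), ⟨_, rfl⟩, ?_⟩, ⟨d, hd, g (b + ε), ⟨_, rfl⟩, ?_⟩⟩
    · simp [f', add_assoc]
    · change d + g (b + ε) = c + f a + f δ
      rw [h0, h1, map_add, add_assoc]

/-- The combinatorial form of the Hilbert–Serre theorem. -/
theorem isClasswisePoly_ncard_add_closure [IsCancelAdd M] (w : M →+ ℕ) (t : Finset M)
    (hw : ∀ p ∈ t, 1 ≤ w p) {C : Set M} (hC : C.Finite) :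
    (∀ n, {x ∈ C + (closure (t : Set M) : Set M) | w x = n}.Finite) ∧
      IsClasswisePoly fun n => ({x ∈ C + (closure (t : Set M) : Set M) | w x = n}.ncard : ℤ) := by
  classical
  induction t using Finset.induction_on generalizing C with
  | empty =>
    have h0 : C + (closure ((∅ : Finset M) : Set M) : Set M) = C := by simp
    rw [h0]
    refine ⟨fun n => hC.subset fun x hx => hx.1, (IsClasswisePoly.const 0).congr ?_⟩
    obtain ⟨b, hb⟩ := (hC.image w).bddAbove
    filter_upwards [eventually_gt_atTop b] with n hn
    have : {x ∈ C | w x = n} = ∅ := by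
      refine Set.eq_empty_of_forall_notMem fun x hx => ?_
      have := hb ⟨x, hx.1, hx.2⟩
      omega
    simp [this]
  | insert p t hp ih =>
    have hwt : ∀ q ∈ t, 1 ≤ w q := fun q hq => hw q (by simp [hq])
    have hwp : 1 ≤ w p := hw p (by simp)
    set N : AddSubmonoid M := closure ((insert p t : Finset M) : Set M) with hN
    have hpN : p ∈ N := subset_closure (by simp)
    have htN : closure (t : Set M) ≤ N := closure_mono (by simp)
    set A : Set M := C + (N : Set M) with hA
    set A' : Set M := C + (closure (t : Set M) : Set M) with hA'
    have hAp : ∀ x ∈ A, p + x ∈ A := by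
      rintro _ ⟨c, hc, m, hm, rfl⟩
      exact ⟨c, hc, p + m, add_mem hpN hm, add_left_comm _ _ _⟩
    have hsplit : ∀ x ∈ A, x ∈ A' ∨ ∃ y ∈ A, p + y = x := by
      rintro _ ⟨c, hc, m, hm, rfl⟩
      rw [SetLike.mem_coe, hN, Finset.coe_insert, Set.insert_eq,
        AddSubmonoid.closure_union, AddSubmonoid.mem_sup] at hm
      obtain ⟨q, hq, m, hm, rfl⟩ := hm
      obtain ⟨j, rfl⟩ := mem_closure_singleton.1 hq
      cases j with
      | zero => exact Or.inl ⟨c, hc, m, hm, by simp⟩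
      | succ j =>
        refine Or.inr ⟨c + (j • p + m), ⟨c, hc, _, add_mem (nsmul_mem hpN _) (htN hm), rfl⟩, ?_⟩
        simp only [succ_nsmul]
        abel
    have hA'A : A' ⊆ A := Set.add_subset_add_left htN
    have hfin : ∀ n, {x ∈ A | w x = n}.Finite := by
      intro n
      induction n using Nat.strong_induction_on with
      | _ n ihn =>
        have h1 : ({x ∈ A' | w x = n} ∪
            (p + ·) '' (⋃ j ∈ Finset.range n, {x ∈ A | w x = j})).Finite :=
          ((ih hwt hC).1 n).union (Set.Finite.image _ (Set.Finite.biUnion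
            (Finset.finite_toSet _) fun j hj => ihn j (Finset.mem_range.1 hj)))
        refine h1.subset fun x hx => ?_
        rcases hsplit x hx.1 with h | ⟨y, hy, rfl⟩
        · exact Or.inl ⟨h, hx.2⟩
        · have := hx.2
          rw [map_add] at this
          exact Or.inr ⟨y, Set.mem_biUnion (x := w y)
            (by simp only [Finset.coe_range, Set.mem_Iio]; omega) ⟨hy, rfl⟩, rfl⟩
    refine ⟨hfin, ?_⟩
    obtain ⟨C', hC', hY⟩ := exists_finite_add_closure_eq (Y := A' ∩ ((p + ·) '' A)) hC
      t.finite_toSet Set.inter_subset_left (by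
        rintro _ ⟨⟨c, hc, m, hm, rfl⟩, ⟨_, ⟨d, hd, k, hk, rfl⟩, hy⟩⟩ m' hm'
        refine ⟨⟨c, hc, m + m', add_mem hm hm', (add_assoc _ _ _).symm⟩,
          d + k + m', ⟨d, hd, k + m', add_mem hk (htN hm'), (add_assoc _ _ _).symm⟩, ?_⟩
        rw [← hy]
        exact (add_assoc _ _ _).symm)
    refine IsClasswisePoly.of_sub (w := w p) hwp (h := fun n =>
      ({x ∈ A' | w x = n + w p}.ncard : ℤ) -
        ({x ∈ C' + (closure (t : Set M) : Set M) | w x = n + w p}.ncard : ℤ))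
      ?_ (.of_forall fun n => ?_)
    · have hshift : ∀ {g : ℕ → ℤ} (v : ℕ), IsClasswisePoly g →
          IsClasswisePoly fun n => g (n + v) := by
        rintro g v ⟨q, hq, H⟩
        exact ⟨q, hq, fun r => by simpa only [add_assoc] using H (r + v)⟩
      exact (hshift _ (ih hwt hC).2).sub (hshift _ (ih hwt hC').2)
    · have hdec : {x ∈ A | w x = n + w p} =
          {x ∈ A' | w x = n + w p} ∪ (p + ·) '' {x ∈ A | w x = n} := by
        ext x
        constructor
        · rintro ⟨hx, hxn⟩
          rcases hsplit x hx with h | ⟨y, hy, rfl⟩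
          · exact Or.inl ⟨h, hxn⟩
          · exact Or.inr ⟨y, ⟨hy, by rw [map_add] at hxn; omega⟩, rfl⟩
        · rintro (⟨hx, hxn⟩ | ⟨y, ⟨hy, rfl⟩, rfl⟩)
          · exact ⟨hA'A hx, hxn⟩
          · exact ⟨hAp y hy, by simp [add_comm]⟩
      have hint : {x ∈ A' | w x = n + w p} ∩ (p + ·) '' {x ∈ A | w x = n} =
          {x ∈ C' + (closure (t : Set M) : Set M) | w x = n + w p} := by
        rw [← hY]
        ext x
        constructor
        · rintro ⟨⟨hx, hxn⟩, y, ⟨hy, rfl⟩, rfl⟩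
          exact ⟨⟨hx, y, hy, rfl⟩, hxn⟩
        · rintro ⟨⟨hx, y, hy, rfl⟩, hxn⟩
          exact ⟨⟨hx, hxn⟩, y, ⟨hy, by rw [map_add] at hxn; omega⟩, rfl⟩
      have hcard := Set.ncard_union_add_ncard_inter {x ∈ A' | w x = n + w p}
        ((p + ·) '' {x ∈ A | w x = n}) ((ih hwt hC).1 _) ((hfin n).image _)
      rw [← hdec, hint, Set.ncard_image_of_injective _ (add_right_injective p)] at hcard
      have : ({x ∈ A | w x = n + w p}.ncard : ℤ) +
          ({x ∈ C' + (closure (t : Set M) : Set M) | w x = n + w p}.ncard : ℤ) =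
          ({x ∈ A' | w x = n + w p}.ncard : ℤ) + ({x ∈ A | w x = n}.ncard : ℤ) := by
        exact_mod_cast hcard
      linarith

variable {κ : Type*} {w : (κ → ℕ) →+ ℕ}

theorem isClasswisePoly_ncard {X : Set (κ → ℕ)} (hX : IsFGShift X)
    (hfin : ∀ n, {x ∈ X | w x = n}.Finite) :
    IsClasswisePoly fun n => ({x ∈ X | w x = n}.ncard : ℤ) := by
  classical
  obtain ⟨C, t, hC, ht, rfl⟩ := hX
  rcases C.eq_empty_or_nonempty with rfl | ⟨c, hc⟩
  · simpa using IsClasswisePoly.const 0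
  have hcl : AddSubmonoid.closure ((ht.toFinset.erase 0 : Finset (κ → ℕ)) : Set (κ → ℕ)) =
      AddSubmonoid.closure t := by
    rw [Finset.coe_erase, Set.Finite.coe_toFinset, closure_sdiff_singleton_zero]
  rw [← hcl] at hfin ⊢
  refine (isClasswisePoly_ncard_add_closure w _ (fun p hp => ?_) hC).2
  by_contra hwp
  have hp0 : p ≠ 0 := (Finset.mem_erase.1 hp).1
  obtain ⟨i, hi⟩ := Function.ne_iff.1 hp0
  refine Set.infinite_of_injective_forall_mem (f := fun j : ℕ => c + j • p) (fun a b hab => ?_)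
    (fun j => ?_) (hfin (w c))
  · have := congrFun hab i
    simp only [Pi.add_apply, Pi.smul_apply, smul_eq_mul, add_right_inj] at this
    exact Nat.eq_of_mul_eq_mul_right (Nat.pos_of_ne_zero hi) this
  · refine ⟨⟨c, hc, j • p, nsmul_mem (subset_closure hp) _, rfl⟩, ?_⟩
    rw [map_add, map_nsmul, show w p = 0 by omega]
    simp

theorem isClasswisePoly_ncard_biUnion (L : List (Set (κ → ℕ))) (hL : ∀ X ∈ L, IsFGShift X)
    (hfin : ∀ X ∈ L, ∀ n, {x ∈ X | w x = n}.Finite) :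
    IsClasswisePoly fun n => ({x | (∃ X ∈ L, x ∈ X) ∧ w x = n}.ncard : ℤ) := by
  induction hl : L.length generalizing L with
  | zero =>
    rw [List.length_eq_zero_iff] at hl
    subst hl
    simpa using IsClasswisePoly.const 0
  | succ l ih =>
    obtain ⟨A, L, rfl⟩ := List.exists_cons_of_length_eq_add_one hl
    have hA := hL A (by simp)
    have hAf := hfin A (by simp)
    have hlen : L.length = l := by simpa using hl
    have h1 := hA.isClasswisePoly_ncard hAf
    have h2 := ih L (fun X hX => hL X (by simp [hX])) (fun X hX => hfin X (by simp [hX])) hlen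
    have h3 := ih (L.map (A ∩ ·)) (by
      simp only [List.mem_map]
      rintro _ ⟨X, hX, rfl⟩
      exact hA.inter (hL X (by simp [hX]))) (by
      simp only [List.mem_map]
      rintro _ ⟨X, hX, rfl⟩ n
      exact (hAf n).subset fun x hx => ⟨hx.1.1, hx.2⟩) (by simpa using hlen)
    refine ((h1.add h2).sub h3).congr (.of_forall fun n => ?_)
    have hLf : {x | (∃ X ∈ L, x ∈ X) ∧ w x = n}.Finite := by
      refine (Set.Finite.biUnion L.finite_toSet fun X hX => hfin X (by
        simp [show X ∈ L from hX]) n).subset ?_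
      rintro x ⟨⟨X, hX, hx⟩, hxn⟩
      exact Set.mem_biUnion (show X ∈ {X | X ∈ L} from hX) ⟨hx, hxn⟩
    have hcard := Set.ncard_union_add_ncard_inter {x ∈ A | w x = n}
      {x | (∃ X ∈ L, x ∈ X) ∧ w x = n} (hAf n) hLf
    have hu : {x ∈ A | w x = n} ∪ {x | (∃ X ∈ L, x ∈ X) ∧ w x = n} =
        {x | (∃ X ∈ A :: L, x ∈ X) ∧ w x = n} := by
      ext x
      simp only [Set.mem_union, Set.mem_ofPred_eq, List.mem_cons, exists_eq_or_imp]
      tauto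
    have hi : {x ∈ A | w x = n} ∩ {x | (∃ X ∈ L, x ∈ X) ∧ w x = n} =
        {x | (∃ X ∈ L.map (A ∩ ·), x ∈ X) ∧ w x = n} := by
      ext x
      simp only [Set.mem_inter_iff, Set.mem_ofPred_eq, List.mem_map, exists_exists_and_eq_and]
      constructor
      · rintro ⟨⟨hxA, hxn⟩, ⟨X, hX, hx⟩, -⟩
        exact ⟨⟨X, hX, hxA, hx⟩, hxn⟩
      · rintro ⟨⟨X, hX, hxA, hx⟩, hxn⟩
        exact ⟨⟨hxA, hxn⟩, ⟨X, hX, hx⟩, hxn⟩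
    rw [hu, hi] at hcard
    exact sub_eq_of_eq_add (by exact_mod_cast hcard.symm)

end IsFGShift

/-- The fibres of a semilinear set along a linear grading have classwise polynomial cardinality. -/
theorem IsSemilinearSet.isClasswisePoly_ncard {κ : Type*} {w : (κ → ℕ) →+ ℕ} {X : Set (κ → ℕ)}
    (hX : IsSemilinearSet X) (hfin : ∀ n, {x ∈ X | w x = n}.Finite) :
    IsClasswisePoly fun n => ({x ∈ X | w x = n}.ncard : ℤ) := by
  obtain ⟨S, hS, rfl⟩ := isSemilinearSet_iff.1 hX
  have := IsFGShift.isClasswisePoly_ncard_biUnion (w := w) S.toList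
    (fun X hX => IsFGShift.of_isLinearSet (hS X (by simpa using hX)))
    (fun X hX n => (hfin n).subset fun x hx =>
      ⟨Set.mem_sUnion.2 ⟨X, by simpa using hX, hx.1⟩, hx.2⟩)
  refine this.congr (.of_forall fun n => ?_)
  congr 2
  ext x
  simp

section Digits

theorem isSemilinearSet_int_linear_eq {κ : Type*} [Fintype κ] (a : κ → ℤ) (q : ℤ) :
    IsSemilinearSet {x : κ → ℕ | ∑ v, a v * (x v : ℤ) + q = 0} := by
  let φ : (κ → ℕ) → (κ → ℕ) →+ ℕ := fun c =>
    { toFun := fun x => ∑ v, c v * x v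
      map_zero' := by simp
      map_add' := fun x y => by simp [mul_add, Finset.sum_add_distrib] }
  have := isSemilinearSet_setOfPred_eq q.toNat (-q).toNat (φ fun v => (a v).toNat)
    (φ fun v => (-a v).toNat)
  convert this using 3 with x
  have h : ∀ z : ℤ, z = (z.toNat : ℤ) - ((-z).toNat : ℤ) := fun z => by omega
  have hsum : ∑ v, a v * (x v : ℤ) =
      ∑ v, ((a v).toNat : ℤ) * x v - ∑ v, ((-a v).toNat : ℤ) * x v := by
    rw [← Finset.sum_sub_distrib]
    refine Finset.sum_congr rfl fun v _ => ?_
    rw [← sub_mul, ← h]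
  simp only [φ, AddMonoidHom.coe_mk, ZeroHom.coe_mk]
  zify
  rw [hsum]
  have := h q
  constructor <;> intro <;> linarith

theorem isSemilinearSet_apply_lt {κ : Type*} [Finite κ] (a b : κ) :
    IsSemilinearSet {x : κ → ℕ | x a < x b} := by
  have h : {x : κ → ℕ | x a < x b} = {x | ∃ y : Unit → ℕ, x a + 1 + y () = x b} := by
    ext x
    constructor
    · intro h
      exact ⟨fun _ => x b - (x a + 1), Nat.add_sub_of_le h⟩
    · rintro ⟨y, hy⟩
      change x a < x b
      omega
  rw [h]
  refine IsSemilinearSet.proj' (p := fun x y => x a + 1 + y () = x b) ?_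
  have := isSemilinearSet_setOfPred_eq 1 0
    (Pi.evalAddMonoidHom (fun _ : κ ⊕ Unit => ℕ) (Sum.inl a) +
      Pi.evalAddMonoidHom (fun _ : κ ⊕ Unit => ℕ) (Sum.inr ()))
    (Pi.evalAddMonoidHom (fun _ : κ ⊕ Unit => ℕ) (Sum.inl b))
  convert this using 3 with x
  simp only [Function.comp_apply, AddMonoidHom.add_apply, Pi.evalAddMonoidHom_apply]
  omega

variable {V : Type*} [Fintype V]

/-- Vectors of digits in base `x none`. -/
def digitBox (V : Type*) : Set (Option V → ℕ) :=
  {x | 1 ≤ x none ∧ ∀ v, x (some v) < x none}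

theorem isSemilinearSet_digitBox : IsSemilinearSet (digitBox V) := by
  have h : digitBox V = {x | ∑ v : Option V, (if v = none then (1 : ℤ) else 0) * (x v : ℤ) + 0 = 0}ᶜ
      ∩ ⋂ v : V, {x : Option V → ℕ | x (some v) < x none} := by
    ext x
    simp [digitBox, Nat.one_le_iff_ne_zero]
  rw [h]
  classical
  exact (isSemilinearSet_int_linear_eq _ _).compl.inter
    (.iInter fun v => isSemilinearSet_apply_lt _ _)

/-- A linear equation between digits whose coefficients are polynomials in the base is semilinear:
carries are bounded, so it splits into finitely many systems with constant coefficients. -/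
theorem isSemilinearSet_digit_eq (P : V → Polynomial ℤ) (q : ℤ) :
    IsSemilinearSet {x ∈ digitBox V |
      ∑ v, (P v).eval (x none : ℤ) * (x (some v) : ℤ) + q = 0} := by
  classical
  obtain ⟨d, hd⟩ : ∃ d : ℕ, ∀ v, ∀ i ≥ d, (P v).coeff i = 0 := by
    refine ⟨(Finset.univ.sup fun v => (P v).natDegree) + 1, fun v i hi => ?_⟩
    refine Polynomial.coeff_eq_zero_of_natDegree_lt (lt_of_lt_of_le (Nat.lt_succ_of_le ?_) hi)
    exact Finset.le_sup (f := fun v => (P v).natDegree) (Finset.mem_univ v)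
  induction d generalizing P q with
  | zero =>
    have h0 : ∀ v, P v = 0 := fun v => Polynomial.ext fun i => by simpa using hd v i (Nat.zero_le i)
    by_cases hq : q = 0
    · simpa [h0, hq] using isSemilinearSet_digitBox
    · simp [h0, hq]
  | succ d ih =>
    have ih' := fun q' => ih (fun v => (P v).divX) q' fun v i hi => by
      rw [Polynomial.coeff_divX]
      exact hd v (i + 1) (by omega)
    let a : V → ℤ := fun v => (P v).coeff 0
    let A : ℤ := ∑ v, |a v| + |q|
    have hset : {x ∈ digitBox V | ∑ v, (P v).eval (x none : ℤ) * (x (some v) : ℤ) + q = 0} =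
        ⋃ q' ∈ Finset.Icc (-A) A,
          ({x : Option V → ℕ | ∑ v, (v.elim (-q') a) * (x v : ℤ) + q = 0} ∩
          {x ∈ digitBox V |
            ∑ v, ((P v).divX).eval (x none : ℤ) * (x (some v) : ℤ) + q' = 0}) := by
      ext x
      simp only [Set.mem_iUnion, Set.mem_inter_iff, Set.mem_ofPred_eq, Fintype.sum_option,
        Option.elim]
      have hexp : ∑ v, (P v).eval (x none : ℤ) * (x (some v) : ℤ) =
          (x none : ℤ) * ∑ v, ((P v).divX).eval (x none : ℤ) * (x (some v) : ℤ) +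
            ∑ v, a v * (x (some v) : ℤ) := by
        rw [Finset.mul_sum, ← Finset.sum_add_distrib]
        refine Finset.sum_congr rfl fun v _ => ?_
        conv_lhs => rw [← Polynomial.divX_mul_X_add (P v)]
        simp only [Polynomial.eval_add, Polynomial.eval_mul, Polynomial.eval_X,
          Polynomial.eval_C, a]
        ring
      constructor
      · rintro ⟨hx, h⟩
        set T := ∑ v, ((P v).divX).eval (x none : ℤ) * (x (some v) : ℤ)
        have hpos : (1 : ℤ) ≤ x none := by exact_mod_cast hx.1
        have hbound : |∑ v, a v * (x (some v) : ℤ) + q| ≤ A * x none := by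
          calc |∑ v, a v * (x (some v) : ℤ) + q|
              ≤ |∑ v, a v * (x (some v) : ℤ)| + |q| := abs_add_le _ _
            _ ≤ ∑ v, |a v * (x (some v) : ℤ)| + |q| := by
                gcongr
                exact Finset.abs_sum_le_sum_abs _ _
            _ ≤ ∑ v, |a v| * x none + |q| * x none := by
                gcongr with v
                · rw [abs_mul, Nat.abs_cast]
                  gcongr
                  exact (hx.2 v).le
                · nlinarith [abs_nonneg q]
            _ = A * x none := by rw [← Finset.sum_mul, ← add_mul]
        have hT : ∑ v, a v * (x (some v) : ℤ) + q = -(x none * T) := by linarith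
        rw [hT, abs_neg, abs_mul, Nat.abs_cast, mul_comm] at hbound
        have hTA : |T| ≤ A := le_of_mul_le_mul_right hbound (by linarith)
        rw [abs_le] at hTA
        refine ⟨-T, Finset.mem_Icc.2 ⟨by linarith, by linarith⟩, ?_, hx, by ring⟩
        linarith
      · rintro ⟨q', -, h1, hx, h2⟩
        refine ⟨hx, ?_⟩
        rw [hexp, eq_neg_of_add_eq_zero_left h2]
        linarith
    rw [hset]
    exact .biUnion_finset fun q' _ => (isSemilinearSet_int_linear_eq _ _).inter (ih' q')

variable {ι μ : Type*} [Fintype ι] [Fintype μ]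

theorem isSemilinearSet_digit_fibre (F : ι → ℕ → μ → ℕ)
    (hF : ∀ i j, ∃ p : Polynomial ℤ, ∀ n : ℕ, ((F i n j : ℤ) = p.eval (n : ℤ)))
    (r s : ℕ) (i₁ i₂ : ι) :
    IsSemilinearSet {x ∈ digitBox (μ × Fin r) | ∃ ζ : ι × Fin s → ℕ, (∀ v, ζ v < x none) ∧
      (∀ j, ∑ i, (∑ l, ζ (i, l) * x none ^ (l : ℕ)) * F i (x none) j =
        ∑ l, x (some (j, l)) * x none ^ (l : ℕ)) ∧
      (∃ l, ζ (i₁, l) ≠ 0) ∧ ∃ l, ζ (i₂, l) ≠ 0} := by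
  classical
  choose p hp using hF
  let W := (μ × Fin r) ⊕ (ι × Fin s)
  let P : μ → W → Polynomial ℤ := fun j => Sum.elim
    (fun v => if v.1 = j then -Polynomial.X ^ (v.2 : ℕ) else 0)
    (fun v => p v.1 j * Polynomial.X ^ (v.2 : ℕ))
  let E : Set (Option W → ℕ) := digitBox W ∩
    (⋂ j, {x ∈ digitBox W |
      ∑ v, (P j v).eval (x none : ℤ) * (x (some v) : ℤ) + 0 = 0}) ∩
    ((⋃ l, {x | ∑ v, (if v = some (Sum.inr (i₁, l)) then (1 : ℤ) else 0) * (x v : ℤ) + 0 = 0}ᶜ) ∩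
    (⋃ l, {x | ∑ v, (if v = some (Sum.inr (i₂, l)) then (1 : ℤ) else 0) * (x v : ℤ) + 0 = 0}ᶜ))
  have hE : IsSemilinearSet E :=
    (isSemilinearSet_digitBox.inter (.iInter fun j => isSemilinearSet_digit_eq _ _)).inter
      ((IsSemilinearSet.iUnion fun l => (isSemilinearSet_int_linear_eq _ _).compl).inter
        (.iUnion fun l => (isSemilinearSet_int_linear_eq _ _).compl))
  have himage := hE.image
    (LinearMap.funLeft ℕ ℕ (Option.map Sum.inl : Option (μ × Fin r) → Option W))
  have hEmem : ∀ y : Option W → ℕ, y ∈ E ↔ y ∈ digitBox W ∧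
      (∀ j, ∑ i, (∑ l, y (some (.inr (i, l))) * y none ^ (l : ℕ)) * F i (y none) j =
        ∑ l, y (some (.inl (j, l))) * y none ^ (l : ℕ)) ∧
      (∃ l, y (some (.inr (i₁, l))) ≠ 0) ∧ ∃ l, y (some (.inr (i₂, l))) ≠ 0 := by
    intro y
    have heq : ∀ j, (∑ v, (P j v).eval (y none : ℤ) * (y (some v) : ℤ) + 0 = 0) ↔
        ∑ i, (∑ l, y (some (.inr (i, l))) * y none ^ (l : ℕ)) * F i (y none) j =
        ∑ l, y (some (.inl (j, l))) * y none ^ (l : ℕ) := by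
      intro j
      have h1 : ∑ v : μ × Fin r, (P j (.inl v)).eval (y none : ℤ) * (y (some (.inl v)) : ℤ) =
          -∑ l, (y (some (.inl (j, l))) : ℤ) * (y none : ℤ) ^ (l : ℕ) := by
        rw [Fintype.sum_prod_type, Finset.sum_eq_single j]
        · simp [P, mul_comm]
        · intro j' _ hj'
          simp [P, hj']
        · simp
      have h2 : ∑ v : ι × Fin s, (P j (.inr v)).eval (y none : ℤ) * (y (some (.inr v)) : ℤ) =
          ∑ i, (∑ l, (y (some (.inr (i, l))) : ℤ) * (y none : ℤ) ^ (l : ℕ)) * F i (y none) j := by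
        rw [Fintype.sum_prod_type]
        refine Finset.sum_congr rfl fun i _ => ?_
        rw [Finset.sum_mul]
        refine Finset.sum_congr rfl fun l _ => ?_
        simp only [P, Sum.elim_inr, Polynomial.eval_mul, Polynomial.eval_pow, Polynomial.eval_X,
          ← hp]
        ring
      rw [Fintype.sum_sum_type, h1, h2]
      zify
      constructor <;> intro h <;> linarith
    simp only [E, Set.mem_inter_iff, Set.mem_iInter, Set.mem_iUnion, Set.mem_compl_iff,
      Set.mem_ofPred_eq, heq]
    simp only [add_zero, ite_mul, one_mul, zero_mul, Finset.sum_ite_eq', Finset.mem_univ, if_true,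
      Nat.cast_eq_zero]
    exact ⟨fun h => ⟨h.1.1, fun j => (h.1.2 j).2, h.2⟩,
      fun h => ⟨⟨h.1, fun j => ⟨h.1, h.2.1 j⟩⟩, h.2.2⟩⟩
  convert himage using 1
  ext x
  constructor
  · rintro ⟨hx, ζ, hζ, h1, h2, h3⟩
    refine ⟨fun o => o.elim (x none) (Sum.elim (fun v => x (some v)) ζ), (hEmem _).2
      ⟨⟨hx.1, ?_⟩, h1, h2, h3⟩, ?_⟩
    · rintro (v | v)
      · exact hx.2 v
      · exact hζ v
    · ext (_ | v) <;> rfl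
  · rintro ⟨y, hy, rfl⟩
    obtain ⟨hy, h1, h2, h3⟩ := (hEmem y).1 hy
    exact ⟨⟨hy.1, fun v => hy.2 _⟩, fun v => y (some (.inr v)), fun v => hy.2 _, h1, h2, h3⟩

end Digits

section SmallSolutions

theorem Multiset.exists_list_partial_sums_le {α : Type*} [DecidableEq α] (v : α → ℤ) (M : ℕ)
    (s : Multiset α) (hs : ∀ a ∈ s, |v a| ≤ M) (h0 : (s.map v).sum = 0) (j : ℕ) (hj : j ≤ s.card) :
    ∃ l : List α, l.length = j ∧ (l : Multiset α) ≤ s ∧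
      ∀ i ≤ j, |((l.take i).map v).sum| ≤ M := by
  induction j with
  | zero => exact ⟨[], rfl, by simp, by simp⟩
  | succ j ih =>
    obtain ⟨l, hl, hls, hpre⟩ := ih (by omega)
    obtain ⟨u, rfl⟩ := Multiset.le_iff_exists_add.1 hls
    have hu : u ≠ 0 := by
      rintro rfl
      simp [hl] at hj
    have hsum : (l.map v).sum + (u.map v).sum = 0 := by simpa using h0
    have hlM : |(l.map v).sum| ≤ M := by
      have := hpre j le_rfl
      rwa [← hl, List.take_length] at this
    have key : ∃ a ∈ u, |(l.map v).sum + v a| ≤ M := by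
      rcases lt_or_ge 0 (l.map v).sum with h | h
      · have : ∃ a ∈ u, v a < 0 := by
          by_contra! hc
          have : 0 ≤ (u.map v).sum := Multiset.sum_nonneg (by simpa using hc)
          omega
        obtain ⟨a, ha, hav⟩ := this
        refine ⟨a, ha, ?_⟩
        have := hs a (by simp [ha])
        rw [abs_le] at *
        omega
      · have : ∃ a ∈ u, 0 ≤ v a := by
          by_contra! hc
          obtain ⟨b, hb⟩ := Multiset.exists_mem_of_ne_zero hu
          obtain ⟨u', rfl⟩ := Multiset.exists_cons_of_mem hb
          have h1 : (u'.map v).sum ≤ (u'.map v).card • 0 :=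
            Multiset.sum_le_card_nsmul _ _ (by
              simp only [Multiset.mem_map]
              rintro _ ⟨a, ha, rfl⟩
              exact (hc a (by simp [ha])).le)
          rw [smul_zero] at h1
          have h2 := hc b hb
          simp only [Multiset.map_cons, Multiset.sum_cons] at hsum
          omega
        obtain ⟨a, ha, hav⟩ := this
        refine ⟨a, ha, ?_⟩
        have := hs a (by simp [ha])
        rw [abs_le] at *
        omega
    obtain ⟨a, ha, hle⟩ := key
    refine ⟨l ++ [a], by simp [hl], ?_, fun i hi => ?_⟩
    · rw [← Multiset.coe_add]
      gcongr
      simpa using ha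
    · rcases Nat.lt_or_ge j i with h | h
      · rw [List.take_of_length_le (by simp [hl]; omega)]
        simpa using hle
      · rw [List.take_append_of_le_length (by omega)]
        exact hpre i h

theorem Multiset.exists_le_sum_eq_zero {α : Type*} (v : α → ℤ) (M : ℕ) (s : Multiset α)
    (hs : ∀ a ∈ s, |v a| ≤ M) (h0 : (s.map v).sum = 0) (hne : s ≠ 0) :
    ∃ t ≤ s, t ≠ 0 ∧ t.card ≤ 2 * M + 1 ∧ (t.map v).sum = 0 := by
  classical
  rcases Nat.lt_or_ge s.card (2 * M + 2) with h | h
  · exact ⟨s, le_rfl, hne, by omega, h0⟩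
  obtain ⟨l, hl, hls, hpre⟩ := s.exists_list_partial_sums_le v M hs h0 (2 * M + 2) h
  obtain ⟨i, hi, i', hi', hii, heq⟩ := Finset.exists_ne_map_eq_of_card_lt_of_maps_to
    (s := Finset.range (2 * M + 2)) (t := Finset.Icc (-(M : ℤ)) M)
    (f := fun i => ((l.take i).map v).sum) (by simp; omega) (fun i hi => by
      have := hpre i (by simp at hi; omega)
      simpa [abs_le] using this)
  wlog hlt : i < i' generalizing i i'
  · exact this i' hi' i hi hii.symm heq.symm (by omega)
  have hi' : i' < 2 * M + 2 := by simpa using hi'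
  refine ⟨((l.take i').drop i : List α), ?_, ?_, ?_, ?_⟩
  · exact (Multiset.coe_le.2 ((List.drop_sublist _ _).trans (List.take_sublist _ _)).subperm).trans
      hls
  · intro h
    have := congrArg Multiset.card h
    simp [hl] at this
    omega
  · simp [hl]
    omega
  · have h1 : l.take i' = (l.take i').take i ++ (l.take i').drop i :=
      (List.take_append_drop _ _).symm
    have h2 : (l.take i').take i = l.take i := by rw [List.take_take, min_eq_left hlt.le]
    have h3 := congrArg (fun l => (l.map v).sum) h1
    simp only [h2, List.map_append, List.sum_append] at h3
    simp only [Multiset.map_coe, Multiset.sum_coe]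
    omega

theorem Multiset.exists_partition_sum_eq_zero {α : Type*} (v : α → ℤ) (M : ℕ) (s : Multiset α)
    (hs : ∀ a ∈ s, |v a| ≤ M) (h0 : (s.map v).sum = 0) :
    ∃ T : Multiset (Multiset α), T.sum = s ∧
      ∀ t ∈ T, t.card ≤ 2 * M + 1 ∧ (t.map v).sum = 0 := by
  classical
  induction hc : s.card using Nat.strong_induction_on generalizing s with
  | _ c ih =>
    rcases eq_or_ne s 0 with rfl | hne
    · exact ⟨0, by simp⟩
    obtain ⟨t, hts, ht0, htc, htv⟩ := s.exists_le_sum_eq_zero v M hs h0 hne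
    obtain ⟨u, rfl⟩ := Multiset.le_iff_exists_add.1 hts
    have htpos : 0 < t.card := Multiset.card_pos.2 ht0
    obtain ⟨T, hT, hTzero⟩ := ih u.card (by simp at hc; omega) u (fun a ha => hs a (by simp [ha]))
      (by simpa [htv] using h0) rfl
    refine ⟨t ::ₘ T, by simp [hT], ?_⟩
    simp only [Multiset.mem_cons, forall_eq_or_imp]
    exact ⟨⟨htc, htv⟩, hTzero⟩

/-- A bound for the size of indecomposable solutions of `s` homogeneous linear equations with
coefficients of absolute value at most `A`. -/
def solutionBound (A : ℕ) : ℕ → ℕ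
  | 0 => 1
  | s + 1 => (2 * (A * solutionBound A s) + 1) * solutionBound A s

theorem exists_solutionBound_le_pow (d s : ℕ) :
    ∃ e : ℕ, ∀ n A : ℕ, 3 ≤ n → A ≤ n ^ d → solutionBound A s ≤ n ^ e := by
  induction s with
  | zero => exact ⟨0, fun n A _ _ => by simp [solutionBound]⟩
  | succ s ih =>
    obtain ⟨e, he⟩ := ih
    refine ⟨1 + d + e + e, fun n A hn hA => ?_⟩
    have h1 := he n A hn hA
    have h2 : 1 ≤ n ^ d * n ^ e := Nat.mul_pos (by positivity) (by positivity)
    have h3 : A * solutionBound A s ≤ n ^ d * n ^ e := Nat.mul_le_mul hA h1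
    calc solutionBound A (s + 1) = (2 * (A * solutionBound A s) + 1) * solutionBound A s := rfl
      _ ≤ (n * (n ^ d * n ^ e)) * n ^ e := Nat.mul_le_mul (by nlinarith) h1
      _ = n ^ (1 + d + e + e) := by ring

/-- Every nonnegative solution of a homogeneous linear system is a sum of small solutions. -/
theorem exists_multiset_sum_eq_of_solution {σ μ : Type*} [Fintype σ] (c : μ → σ → ℤ) (A : ℕ)
    (hA : ∀ j i, |c j i| ≤ A) (J : Finset μ) (x : σ → ℕ)
    (hx : ∀ j ∈ J, ∑ i, c j i * (x i : ℤ) = 0) :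
    ∃ T : Multiset (σ → ℕ), T.sum = x ∧ ∀ y ∈ T,
      (∀ j ∈ J, ∑ i, c j i * (y i : ℤ) = 0) ∧ ∑ i, y i ≤ solutionBound A J.card := by
  classical
  induction J using Finset.induction_on with
  | empty =>
    refine ⟨∑ i, Multiset.replicate (x i) (Pi.single i 1), ?_, fun y hy => ?_⟩
    · rw [Multiset.sum_sum]
      ext i
      simp [Finset.sum_apply, Pi.single_apply]
    · simp only [Multiset.mem_sum, Multiset.mem_replicate] at hy
      obtain ⟨i, -, -, rfl⟩ := hy
      simp [solutionBound, Pi.single_apply]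
  | insert j J hj ih =>
    obtain ⟨T, hT, hTy⟩ := ih fun j' hj' => hx j' (by simp [hj'])
    let v : (σ → ℕ) →+ ℤ :=
      { toFun := fun y => ∑ i, c j i * (y i : ℤ)
        map_zero' := by simp
        map_add' := fun y z => by simp [mul_add, Finset.sum_add_distrib] }
    have hv : ∀ y ∈ T, |v y| ≤ (A * solutionBound A J.card : ℕ) := by
      intro y hy
      calc |v y| ≤ ∑ i, |c j i * (y i : ℤ)| := Finset.abs_sum_le_sum_abs _ _
        _ ≤ ∑ i, (A : ℤ) * y i := by
            gcongr with i
            rw [abs_mul, Nat.abs_cast]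
            exact mul_le_mul_of_nonneg_right (hA j i) (by positivity)
        _ = (A : ℤ) * (∑ i, y i : ℕ) := by rw [← Finset.mul_sum]; push_cast; rfl
        _ ≤ (A * solutionBound A J.card : ℕ) := by
            push_cast
            gcongr
            exact_mod_cast (hTy y hy).2
    have hsum : (T.map v).sum = 0 := by
      rw [← map_multiset_sum, hT]
      exact hx j (by simp)
    obtain ⟨G, hG, hGt⟩ := T.exists_partition_sum_eq_zero v _ hv hsum
    refine ⟨G.map Multiset.sum, ?_, ?_⟩
    · rw [← Multiset.sum_join, Multiset.join, hG, hT]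
    · simp only [Multiset.mem_map]
      rintro _ ⟨t, ht, rfl⟩
      have htT : ∀ y ∈ t, y ∈ T := fun y hy => by
        rw [← hG]
        exact Multiset.mem_of_le (Multiset.single_le_sum (fun _ _ => Multiset.zero_le _) t ht) hy
      refine ⟨fun j' hj' => ?_, ?_⟩
      · rcases Finset.mem_insert.1 hj' with rfl | hj'
        · have := (hGt t ht).2
          rwa [← map_multiset_sum] at this
        · let v' : (σ → ℕ) →+ ℤ :=
            { toFun := fun y => ∑ i, c j' i * (y i : ℤ)
              map_zero' := by simp
              map_add' := fun y z => by simp [mul_add, Finset.sum_add_distrib] }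
          change v' t.sum = 0
          rw [map_multiset_sum]
          refine Multiset.sum_eq_zero ?_
          simp only [Multiset.mem_map]
          rintro _ ⟨y, hy, rfl⟩
          exact (hTy y (htT y hy)).1 j' hj'
      · let size : (σ → ℕ) →+ ℕ :=
          { toFun := fun y => ∑ i, y i
            map_zero' := by simp
            map_add' := fun y z => by simp [Finset.sum_add_distrib] }
        change size t.sum ≤ _
        rw [map_multiset_sum, Finset.card_insert_of_notMem hj]
        calc (t.map size).sum ≤ (t.map size).card • solutionBound A J.card :=
              Multiset.sum_le_card_nsmul _ _ (by
                simp only [Multiset.mem_map]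
                rintro _ ⟨y, hy, rfl⟩
                exact (hTy y (htT y hy)).2)
          _ ≤ _ := by
              rw [Multiset.card_map, smul_eq_mul, solutionBound]
              exact Nat.mul_le_mul_right _ (hGt t ht).1

end SmallSolutions

section Components

variable {ι : Type*}

/-- The classes of the vertices of a graph, a vertex being an element related to itself. -/
def compSet (τ : ι → ι → Prop) : Set (Quot τ) := Quot.mk τ '' {i | τ i i}

/-- The number of connected components of a graph. -/
noncomputable def numComp (τ : ι → ι → Prop) : ℕ := (compSet τ).ncard

theorem compSet_finite [Finite ι] (τ : ι → ι → Prop) : (compSet τ).Finite :=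
  (Set.toFinite _).image _

/-- The component of a vertex. -/
def vertexComp {τ : ι → ι → Prop} {i : ι} (hi : τ i i) : compSet τ := ⟨Quot.mk τ i, i, hi, rfl⟩

theorem vertexComp_eq {τ : ι → ι → Prop} {i j : ι} (hi : τ i i) (hj : τ j j) (h : τ i j) :
    vertexComp hi = vertexComp hj :=
  Subtype.ext (Quot.sound h)

end Components

section FibreGraph

variable {ι μ : Type*} [Fintype ι]

/-- The homomorphism `z ↦ ∑ i, z i • a i`. -/
def semigroupHom (a : ι → μ → ℕ) : (ι → ℕ) →+ (μ → ℕ) where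
  toFun z := ∑ i, z i • a i
  map_zero' := by simp
  map_add' z w := by simp [add_smul, Finset.sum_add_distrib]

theorem semigroupHom_apply (a : ι → μ → ℕ) (z : ι → ℕ) : semigroupHom a z = ∑ i, z i • a i := rfl

theorem semigroupHom_apply_apply (a : ι → μ → ℕ) (z : ι → ℕ) (j : μ) :
    semigroupHom a z j = ∑ i, z i * a i j := by
  simp [semigroupHom_apply]

theorem semigroupHom_single [DecidableEq ι] (a : ι → μ → ℕ) (i : ι) :
    semigroupHom a (Pi.single i 1) = a i := by
  simp [semigroupHom_apply, Pi.single_apply]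

theorem semigroupHom_eq_zero_iff {a : ι → μ → ℕ} {z : ι → ℕ} :
    semigroupHom a z = 0 ↔ ∀ i, a i ≠ 0 → z i = 0 := by
  rw [semigroupHom_apply, Finset.sum_eq_zero_iff]
  refine forall_congr' fun i => ?_
  simp only [Finset.mem_univ, true_imp_iff, smul_eq_zero]
  tauto

theorem exists_apply_ne_zero_of_semigroupHom_ne_zero {a : ι → μ → ℕ} {z : ι → ℕ}
    (h : semigroupHom a z ≠ 0) : ∃ i, a i ≠ 0 ∧ z i ≠ 0 := by
  contrapose! h
  exact semigroupHom_eq_zero_iff.2 h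

/-- Two generators are adjacent in the graph of `b` if some factorization of `b` involves both. -/
def FibreAdj (a : ι → μ → ℕ) (b : μ → ℕ) (i j : ι) : Prop :=
  a i ≠ 0 ∧ a j ≠ 0 ∧ ∃ z, semigroupHom a z = b ∧ z i ≠ 0 ∧ z j ≠ 0

theorem numComp_fibreAdj_zero (a : ι → μ → ℕ) : numComp (FibreAdj a 0) = 0 := by
  have : {i | FibreAdj a 0 i i} = ∅ := by
    ext i
    simp only [Set.mem_ofPred_eq, Set.mem_empty_iff_false, iff_false]
    rintro ⟨h, -, z, hz, hi, -⟩
    exact hi (semigroupHom_eq_zero_iff.1 hz i h)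
  simp [numComp, compSet, this]

/-- If the graph of `b` is disconnected then `b` is small. -/
theorem apply_le_of_two_le_numComp [Fintype μ] {a : ι → μ → ℕ} {A : ℕ} (hA : ∀ i j, a i j ≤ A)
    {b : μ → ℕ} (hb : 2 ≤ numComp (FibreAdj a b)) (j : μ) :
    b j ≤ A * solutionBound A (Fintype.card μ) := by
  obtain ⟨_, _, ⟨i, ⟨hi, -, z, hz, hzi, -⟩, rfl⟩, ⟨i', ⟨hi', -, z', hz', hzi', -⟩, rfl⟩, hne⟩ :=
    (Set.one_lt_ncard_iff (compSet_finite _)).1 hb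
  obtain ⟨T, hT, hTy⟩ := exists_multiset_sum_eq_of_solution
    (fun (j : μ) (s : ι ⊕ ι) => Sum.elim (fun i => (a i j : ℤ)) (fun i => -(a i j : ℤ)) s) A
    (by rintro j (i | i) <;> simpa using hA i j) Finset.univ (Sum.elim z z') (fun j _ => by
      have h1 := congrFun hz j
      have h2 := congrFun hz' j
      rw [semigroupHom_apply_apply] at h1 h2
      have h3 : ((∑ i, z i * a i j : ℕ) : ℤ) = (∑ i, z' i * a i j : ℕ) := by rw [h1, h2]
      push_cast at h3
      simp only [Fintype.sum_sum_type, Sum.elim_inl, Sum.elim_inr, neg_mul,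
        Finset.sum_neg_distrib]
      simp only [mul_comm (a _ j : ℤ), h3, add_neg_cancel])
  have hy : ∃ y ∈ T, y (Sum.inl i) ≠ 0 := by
    by_contra! hc
    have h1 : (Pi.evalAddMonoidHom (fun _ => ℕ) (Sum.inl i : ι ⊕ ι)) T.sum = 0 := by
      rw [map_multiset_sum]
      refine Multiset.sum_eq_zero ?_
      simpa using hc
    rw [hT] at h1
    exact hzi h1
  obtain ⟨y, hyT, hyi⟩ := hy
  have hyx : y ≤ Sum.elim z z' := hT ▸ Multiset.single_le_sum (fun _ _ => zero_le) y hyT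
  have huu : semigroupHom a (fun i => y (.inl i)) = semigroupHom a (fun i => y (.inr i)) := by
    ext j
    have h1 := (hTy y hyT).1 j (Finset.mem_univ j)
    simp only [Fintype.sum_sum_type, Sum.elim_inl, Sum.elim_inr, neg_mul,
      Finset.sum_neg_distrib] at h1
    rw [semigroupHom_apply_apply, semigroupHom_apply_apply]
    zify
    simp only [mul_comm _ (a _ j : ℤ)]
    omega
  set u : ι → ℕ := fun i => y (.inl i) with hu
  set u' : ι → ℕ := fun i => y (.inr i) with hu'
  have huz : u ≤ z := fun i => hyx (.inl i)
  have huz' : u' ≤ z' := fun i => hyx (.inr i)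
  obtain ⟨v, rfl⟩ := exists_add_of_le huz
  have hv : semigroupHom a v = 0 := by
    by_contra hv
    obtain ⟨p, hp, hvp⟩ := exists_apply_ne_zero_of_semigroupHom_ne_zero hv
    have hu0 : semigroupHom a u' ≠ 0 := fun h => by
      rw [← huu] at h
      exact hyi (semigroupHom_eq_zero_iff.1 h i hi)
    obtain ⟨l, hl, hul⟩ := exists_apply_ne_zero_of_semigroupHom_ne_zero hu0
    have h1 : FibreAdj a b i p := ⟨hi, hp, _, hz, hzi, by simp [hvp]⟩
    have h2 : FibreAdj a b p l :=
      ⟨hp, hl, u' + v, by rw [← hz, map_add, map_add, huu], by simp [hvp], by simp [hul]⟩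
    have h3 : FibreAdj a b l i' := ⟨hl, hi', z', hz', (hul.bot_lt.trans_le (huz' l)).ne', hzi'⟩
    exact hne ((Quot.sound h1).trans ((Quot.sound h2).trans (Quot.sound h3)))
  have hsize : ∑ i, u i ≤ solutionBound A (Fintype.card μ) := by
    have h1 := (hTy y hyT).2
    rw [Fintype.sum_sum_type, Finset.card_univ] at h1
    exact (Nat.le_add_right _ _).trans h1
  calc b j = ∑ i, u i * a i j := by
        rw [← hz, map_add, hv, add_zero, semigroupHom_apply_apply]
    _ ≤ ∑ i, u i * A := by gcongr with i; exact hA i j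
    _ = A * ∑ i, u i := by rw [← Finset.sum_mul, mul_comm]
    _ ≤ _ := by gcongr

theorem exists_ne_zero_forall_apply_eq_zero {β I : Type*} [Fintype I] (R : Finset β)
    (φ : β → (I → ℚ) →ₗ[ℚ] ℚ) (h : R.card < Fintype.card I) :
    ∃ f ≠ 0, ∀ x ∈ R, φ x f = 0 := by
  have hker : LinearMap.ker (LinearMap.pi fun x : R => φ x) ≠ ⊥ :=
    LinearMap.ker_ne_bot_of_finrank_lt (by simpa using h)
  obtain ⟨f, hf, hf0⟩ := Submodule.exists_mem_ne_zero_of_ne_bot hker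
  refine ⟨f, hf0, fun x hx => ?_⟩
  exact congrFun (LinearMap.mem_ker.1 hf) ⟨x, hx⟩

/-- The pairs of factorizations with the same value, such that factorizations of `b` have the same
value of `f` on their components. -/
def compAddCon (a : ι → μ → ℕ) {b : μ → ℕ} (hb : b ≠ 0) (f : compSet (FibreAdj a b) → ℚ) :
    AddCon (ι → ℕ) where
  r z z' := semigroupHom a z = semigroupHom a z' ∧ (semigroupHom a z = b →
    ∀ i i' (hi : FibreAdj a b i i) (hi' : FibreAdj a b i' i'), z i ≠ 0 → z' i' ≠ 0 →
      f (vertexComp hi) = f (vertexComp hi'))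
  iseqv :=
    { refl := fun z => ⟨rfl, fun hz i i' hi hi' hzi hzi' =>
        congrArg f (vertexComp_eq hi hi' ⟨hi.1, hi'.1, z, hz, hzi, hzi'⟩)⟩
      symm := fun ⟨h, h'⟩ => ⟨h.symm, fun hz i i' hi hi' hzi hzi' =>
        (h' (h.trans hz) i' i hi' hi hzi' hzi).symm⟩
      trans := fun {x y z} ⟨h₁, h₁'⟩ ⟨h₂, h₂'⟩ => ⟨h₁.trans h₂, fun hz i i' hi hi' hzi hzi' => by
        have hy : semigroupHom a y = b := h₁.symm.trans hz
        obtain ⟨l, hl, hyl⟩ := exists_apply_ne_zero_of_semigroupHom_ne_zero (hy ▸ hb)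
        have hll : FibreAdj a b l l := ⟨hl, hl, y, hy, hyl, hyl⟩
        exact (h₁' hz i l hi hll hzi hyl).trans (h₂' hy l i' hll hi' hyl hzi')⟩ }
  add' := by
    rintro z z' w w' ⟨hz, hz'⟩ ⟨hw, hw'⟩
    refine ⟨by rw [map_add, map_add, hz, hw], fun h i i' hi hi' hzi hzi' => ?_⟩
    rw [map_add] at h
    rcases eq_or_ne (semigroupHom a z) 0 with hz0 | hz0
    · have hwb : semigroupHom a w = b := by rwa [hz0, zero_add] at h
      have h1 := semigroupHom_eq_zero_iff.1 hz0 i hi.1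
      have h2 := semigroupHom_eq_zero_iff.1 (hz.symm.trans hz0) i' hi'.1
      exact hw' hwb i i' hi hi' (by simpa [h1] using hzi) (by simpa [h2] using hzi')
    rcases eq_or_ne (semigroupHom a w) 0 with hw0 | hw0
    · have hzb : semigroupHom a z = b := by rwa [hw0, add_zero] at h
      have h1 := semigroupHom_eq_zero_iff.1 hw0 i hi.1
      have h2 := semigroupHom_eq_zero_iff.1 (hw.symm.trans hw0) i' hi'.1
      exact hz' hzb i i' hi hi' (by simpa [h1] using hzi) (by simpa [h2] using hzi')
    obtain ⟨p, hp, hwp⟩ := exists_apply_ne_zero_of_semigroupHom_ne_zero hw0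
    obtain ⟨l, hl, hzl⟩ := exists_apply_ne_zero_of_semigroupHom_ne_zero (hz ▸ hz0)
    have h1 : FibreAdj a b i p := ⟨hi.1, hp, z + w, by rw [map_add, h], hzi, by simp [hwp]⟩
    have h2 : FibreAdj a b p l :=
      ⟨hp, hl, z' + w, by rw [map_add, ← hz, h], by simp [hwp], by simp [hzl]⟩
    have h3 : FibreAdj a b l i' :=
      ⟨hl, hi'.1, z' + w', by rw [map_add, ← hz, ← hw, h], by simp [hzl], hzi'⟩
    exact congrArg f (Subtype.ext
      ((Quot.sound h1).trans ((Quot.sound h2).trans (Quot.sound h3))))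

/-- The finite set `R` generates the kernel congruence of `semigroupHom a`. -/
def IsPresentation (a : ι → μ → ℕ) (R : Finset ((ι → ℕ) × (ι → ℕ))) : Prop :=
  ∀ z z', addConGen (fun x y => (x, y) ∈ R) z z' ↔ semigroupHom a z = semigroupHom a z'

variable {a : ι → μ → ℕ} {R : Finset ((ι → ℕ) × (ι → ℕ))}

theorem IsPresentation.apply_eq (hR : IsPresentation a R) {x : (ι → ℕ) × (ι → ℕ)} (hx : x ∈ R) :
    semigroupHom a x.1 = semigroupHom a x.2 :=
  (hR _ _).1 (AddConGen.Rel.of _ _ hx)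

theorem IsPresentation.rel_of_apply_eq (hR : IsPresentation a R) (E : AddCon (ι → ℕ))
    (hE : ∀ x ∈ R, E x.1 x.2) {z z' : ι → ℕ} (h : semigroupHom a z = semigroupHom a z') :
    E z z' :=
  AddCon.addConGen_le.2 (fun x y hxy => hE (x, y) hxy) ((hR z z').2 h)

open Classical in
theorem IsPresentation.numComp_le (hR : IsPresentation a R) {b : μ → ℕ} (hb : b ≠ 0) :
    numComp (FibreAdj a b) ≤ {x ∈ R | semigroupHom a x.1 = b}.card + 1 := by
  by_contra! hlt
  have := (compSet_finite (FibreAdj a b)).fintype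
  have hcard : numComp (FibreAdj a b) = Fintype.card (compSet (FibreAdj a b)) := by
    rw [numComp, Set.ncard_eq_toFinset_card', Set.toFinset_card]
  have hpos : 0 < Fintype.card (compSet (FibreAdj a b)) := by omega
  obtain ⟨q₀⟩ := Fintype.card_pos_iff.1 hpos
  have hφ : ∀ x ∈ {x ∈ R | semigroupHom a x.1 = b},
      ∃ φ : (compSet (FibreAdj a b) → ℚ) →ₗ[ℚ] ℚ, ∀ f, φ f = 0 →
        ∀ i i' (hi : FibreAdj a b i i) (hi' : FibreAdj a b i' i'), x.1 i ≠ 0 → x.2 i' ≠ 0 →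
          f (vertexComp hi) = f (vertexComp hi') := by
    intro x hx
    obtain ⟨hxR, hxb⟩ := Finset.mem_filter.1 hx
    have hxb' : semigroupHom a x.2 = b := (hR.apply_eq hxR).symm.trans hxb
    obtain ⟨l, hl, hxl⟩ := exists_apply_ne_zero_of_semigroupHom_ne_zero (hxb ▸ hb)
    obtain ⟨l', hl', hxl'⟩ := exists_apply_ne_zero_of_semigroupHom_ne_zero (hxb' ▸ hb)
    have hll : FibreAdj a b l l := ⟨hl, hl, _, hxb, hxl, hxl⟩
    have hll' : FibreAdj a b l' l' := ⟨hl', hl', _, hxb', hxl', hxl'⟩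
    refine ⟨LinearMap.proj (R := ℚ) (φ := fun _ => ℚ) (vertexComp hll) -
      LinearMap.proj (vertexComp hll'), fun f hf i i' hi hi' hxi hxi' => ?_⟩
    rw [vertexComp_eq hi hll ⟨hi.1, hl, _, hxb, hxi, hxl⟩,
      vertexComp_eq hi' hll' ⟨hi'.1, hl', _, hxb', hxi', hxl'⟩]
    simpa [sub_eq_zero] using hf
  choose! φ hφ using hφ
  obtain ⟨f, hf0, hf⟩ := exists_ne_zero_forall_apply_eq_zero
    (Finset.insertNone {x ∈ R | semigroupHom a x.1 = b})
    (fun x => x.elim (LinearMap.proj q₀) φ) (by rw [Finset.card_insertNone]; omega)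
  have hfq₀ : f q₀ = 0 := hf none (by simp)
  refine hf0 (funext fun q₁ => ?_)
  obtain ⟨_, i, hi, rfl⟩ := q₀
  obtain ⟨_, i', hi', rfl⟩ := q₁
  obtain ⟨-, -, z, hz, hzi, -⟩ := id hi
  obtain ⟨-, -, z', hz', hzi', -⟩ := id hi'
  have key := hR.rel_of_apply_eq (compAddCon a hb f) (fun x hx => ⟨hR.apply_eq hx, fun hxb =>
    hφ x (by simp [hx, hxb]) f (hf (some x) (by simp [hx, hxb]))⟩) (hz.trans hz'.symm)
  exact (key.2 hz i i' hi hi' hzi hzi').symm.trans hfq₀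

/-- The pairs of factorizations with the same value, such that factorizations of `0` have the same
value of the linear form `f`. -/
def linearAddCon (a : ι → μ → ℕ) (f : ι → ℚ) : AddCon (ι → ℕ) where
  r z z' := semigroupHom a z = semigroupHom a z' ∧
    (semigroupHom a z = 0 → ∑ i, z i * f i = ∑ i, z' i * f i)
  iseqv :=
    { refl := fun z => ⟨rfl, fun _ => rfl⟩
      symm := fun ⟨h, h'⟩ => ⟨h.symm, fun hz => (h' (h.trans hz)).symm⟩
      trans := fun ⟨h₁, h₁'⟩ ⟨h₂, h₂'⟩ =>
        ⟨h₁.trans h₂, fun hz => (h₁' hz).trans (h₂' (h₁.symm.trans hz))⟩ }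
  add' := by
    rintro z z' w w' ⟨hz, hz'⟩ ⟨hw, hw'⟩
    refine ⟨by rw [map_add, map_add, hz, hw], fun h => ?_⟩
    rw [map_add, add_eq_zero] at h
    simp [add_mul, Finset.sum_add_distrib, hz' h.1, hw' h.2]

open Classical in
theorem IsPresentation.card_zero_le (hR : IsPresentation a R) :
    {i | a i = 0}.ncard ≤ {x ∈ R | semigroupHom a x.1 = 0}.card := by
  by_contra! hlt
  obtain ⟨f, hf0, hf⟩ := exists_ne_zero_forall_apply_eq_zero
    {x ∈ R | semigroupHom a x.1 = 0}
    (fun x => ∑ i : {i | a i = 0}, ((x.1 i : ℚ) - x.2 i) • LinearMap.proj i)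
    (by rwa [Set.ncard_eq_toFinset_card', Set.toFinset_card] at hlt)
  let g : ι → ℚ := fun i => if h : a i = 0 then f ⟨i, h⟩ else 0
  have hg : ∀ z : ι → ℕ, ∑ i, z i * g i = ∑ i : {i | a i = 0}, (z i : ℚ) * f i := by
    intro z
    refine (Fintype.sum_of_injective Subtype.val Subtype.val_injective _ _ (fun i hi => ?_)
      fun i => ?_).symm
    · have : a i ≠ 0 := by simpa using hi
      simp [g, this]
    · have : a i = 0 := i.2
      simp [g, this]
  refine hf0 (funext fun i => ?_)
  have key := hR.rel_of_apply_eq (linearAddCon a g) (fun x hx => ⟨hR.apply_eq hx, fun hx0 => by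
    have := hf x (by simp [hx, hx0])
    rw [hg, hg, ← sub_eq_zero, ← Finset.sum_sub_distrib]
    simpa [sub_mul] using this⟩) (z := Pi.single i.1 1) (z' := 0)
    (by rw [semigroupHom_single, map_zero]; exact i.2)
  have h := key.2 (by rw [semigroupHom_single]; exact i.2)
  rw [hg, hg] at h
  simpa [Pi.single_apply, Subtype.coe_inj] using h

theorem IsPresentation.le_card (hR : IsPresentation a R) (B : Finset (μ → ℕ)) :
    {i | a i = 0}.ncard + ∑ b ∈ B, (numComp (FibreAdj a b) - 1) ≤ R.card := by
  classical
  calc {i | a i = 0}.ncard + ∑ b ∈ B, (numComp (FibreAdj a b) - 1)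
      = {i | a i = 0}.ncard + ∑ b ∈ B.erase 0, (numComp (FibreAdj a b) - 1) := by
        rw [Finset.sum_erase _ (by simp [numComp_fibreAdj_zero])]
    _ ≤ {x ∈ R | semigroupHom a x.1 = 0}.card +
          ∑ b ∈ B.erase 0, {x ∈ R | semigroupHom a x.1 = b}.card := by
        refine add_le_add hR.card_zero_le (Finset.sum_le_sum fun b hb => ?_)
        exact Nat.sub_le_of_le_add (hR.numComp_le (Finset.ne_of_mem_erase hb))
    _ = ∑ b ∈ insert 0 (B.erase 0), {x ∈ R | semigroupHom a x.1 = b}.card := by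
        rw [Finset.sum_insert (Finset.notMem_erase _ _)]
    _ ≤ R.card := by
        refine le_of_eq_of_le ?_ (Finset.card_filter_le R
          fun x => semigroupHom a x.1 ∈ insert 0 (B.erase 0))
        rw [← Finset.sum_card_fiberwise_eq_card_filter]

/-- If a congruence relates all factorizations of `b` that have a nonzero generator in common then
it relates all factorizations in the same component. -/
theorem rel_of_quot_mk_eq {b : μ → ℕ} (E : AddCon (ι → ℕ))
    (hE : ∀ i, a i ≠ 0 → ∀ z z', semigroupHom a z = b → semigroupHom a z' = b → z i ≠ 0 →
      z' i ≠ 0 → E z z') {i j : ι} (hij : Quot.mk (FibreAdj a b) i = Quot.mk _ j) :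
    (FibreAdj a b i i ↔ FibreAdj a b j j) ∧ (FibreAdj a b i i →
      ∀ z z', semigroupHom a z = b → semigroupHom a z' = b → z i ≠ 0 → z' j ≠ 0 → E z z') := by
  induction Quot.eqvGen_exact hij with
  | rel i j h =>
    obtain ⟨hi, hj, w, hw, hwi, hwj⟩ := h
    exact ⟨⟨fun _ => ⟨hj, hj, w, hw, hwj, hwj⟩, fun _ => ⟨hi, hi, w, hw, hwi, hwi⟩⟩,
      fun _ z z' hz hz' hzi hzj =>
        E.trans (hE i hi z w hz hw hzi hwi) (hE j hj w z' hw hz' hwj hzj)⟩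
  | refl i => exact ⟨Iff.rfl, fun hi => hE i hi.1⟩
  | symm i j h ih =>
    obtain ⟨h₁, h₂⟩ := ih (Quot.eqvGen_sound h)
    exact ⟨h₁.symm, fun hj z z' hz hz' hzi hzj => E.symm (h₂ (h₁.2 hj) z' z hz' hz hzj hzi)⟩
  | trans i j l h h' ih ih' =>
    obtain ⟨h₁, h₂⟩ := ih (Quot.eqvGen_sound h)
    obtain ⟨h₁', h₂'⟩ := ih' (Quot.eqvGen_sound h')
    refine ⟨h₁.trans h₁', fun hi z z' hz hz' hzi hzl => ?_⟩
    obtain ⟨-, -, w, hw, hwj, -⟩ := id (h₁.1 hi)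
    exact E.trans (h₂ hi z w hz hw hzi hwj) (h₂' (h₁.1 hi) w z' hw hz' hwj hzl)

/-- Joining the components of the graph of `b` along a star. -/
theorem exists_finset_connecting (a : ι → μ → ℕ) {b : μ → ℕ} (hb : b ≠ 0) :
    ∃ R : Finset ((ι → ℕ) × (ι → ℕ)), R.card ≤ numComp (FibreAdj a b) - 1 ∧
      (∀ x ∈ R, semigroupHom a x.1 = b ∧ semigroupHom a x.2 = b) ∧
      ∀ E : AddCon (ι → ℕ), (∀ x ∈ R, E x.1 x.2) →
        (∀ i, a i ≠ 0 → ∀ z z', semigroupHom a z = b → semigroupHom a z' = b → z i ≠ 0 →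
          z' i ≠ 0 → E z z') →
        ∀ z z', semigroupHom a z = b → semigroupHom a z' = b → E z z' := by
  classical
  have hrep : ∀ q ∈ compSet (FibreAdj a b), ∃ (z : ι → ℕ) (i : ι), Quot.mk _ i = q ∧
      FibreAdj a b i i ∧ semigroupHom a z = b ∧ z i ≠ 0 := by
    rintro _ ⟨i, hi, rfl⟩
    obtain ⟨-, -, z, hz, hzi, -⟩ := id hi
    exact ⟨z, i, rfl, hi, hz, hzi⟩
  choose! rep v hv hvv hrep hrepv using hrep
  have hcomp : ∀ z, semigroupHom a z = b →
      ∃ i, z i ≠ 0 ∧ FibreAdj a b i i ∧ Quot.mk (FibreAdj a b) i ∈ compSet (FibreAdj a b) := by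
    intro z hz
    obtain ⟨i, hi, hzi⟩ := exists_apply_ne_zero_of_semigroupHom_ne_zero (hz ▸ hb)
    have hii : FibreAdj a b i i := ⟨hi, hi, z, hz, hzi, hzi⟩
    exact ⟨i, hzi, hii, i, hii, rfl⟩
  rcases (compSet (FibreAdj a b)).eq_empty_or_nonempty with hempty | ⟨q₀, hq₀⟩
  · refine ⟨∅, by simp, by simp, fun E _ _ z z' hz _ => ?_⟩
    obtain ⟨i, -, -, hi⟩ := hcomp z hz
    simp [hempty] at hi
  have hfin := compSet_finite (FibreAdj a b)
  refine ⟨(hfin.toFinset.erase q₀).image fun q => (rep q₀, rep q), ?_, ?_, ?_⟩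
  · refine Finset.card_image_le.trans ?_
    rw [Finset.card_erase_of_mem (by simpa using hq₀), numComp, Set.ncard_eq_toFinset_card _ hfin]
  · simp only [Finset.mem_image, Finset.mem_erase, Set.Finite.mem_toFinset]
    rintro _ ⟨q, ⟨-, hq⟩, rfl⟩
    exact ⟨hrep q₀ hq₀, hrep q hq⟩
  · intro E hER hE
    have key : ∀ z, semigroupHom a z = b → E (rep q₀) z := by
      intro z hz
      obtain ⟨i, hzi, hii, hi⟩ := hcomp z hz
      have h1 : E (rep q₀) (rep (Quot.mk _ i)) := by
        rcases eq_or_ne (Quot.mk _ i) q₀ with h | h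
        · rw [h]
          exact E.refl _
        · exact hER (rep q₀, rep (Quot.mk _ i))
            (Finset.mem_image.2 ⟨Quot.mk _ i, by simp [h, hi], rfl⟩)
      exact E.trans h1 ((rel_of_quot_mk_eq E hE (hv _ hi)).2 (hvv _ hi) _ z (hrep _ hi) hz
        (hrepv _ hi) hzi)
    exact fun z z' hz hz' => E.trans (E.symm (key z hz)) (key z' hz')

theorem AddCon.rel_zero_of_single [DecidableEq ι] (E : AddCon (ι → ℕ)) (z : ι → ℕ)
    (h : ∀ i, z i ≠ 0 → E (Pi.single i 1) 0) : E z 0 := by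
  have hz : z = ∑ i, z i • Pi.single i 1 := by
    ext j
    simp [Finset.sum_apply, Pi.single_apply]
  rw [← AddCon.eq, AddCon.coe_zero, ← AddCon.coe_mk', hz, map_sum]
  refine Finset.sum_eq_zero fun i _ => ?_
  rcases eq_or_ne (z i) 0 with h0 | h0
  · simp [h0]
  · rw [map_nsmul, AddCon.coe_mk', (AddCon.eq E).2 (h i h0)]
    exact nsmul_zero _

theorem exists_isPresentation_card_le [Fintype μ] (a : ι → μ → ℕ) (B : Finset (μ → ℕ))
    (hB : ∀ b, 2 ≤ numComp (FibreAdj a b) → b ∈ B) :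
    ∃ R, IsPresentation a R ∧
      R.card ≤ {i | a i = 0}.ncard + ∑ b ∈ B, (numComp (FibreAdj a b) - 1) := by
  classical
  have hex : ∀ b : μ → ℕ, ∃ R : Finset ((ι → ℕ) × (ι → ℕ)),
      R.card ≤ numComp (FibreAdj a b) - 1 ∧
      (∀ x ∈ R, semigroupHom a x.1 = b ∧ semigroupHom a x.2 = b) ∧
      (b ≠ 0 → ∀ E : AddCon (ι → ℕ), (∀ x ∈ R, E x.1 x.2) →
        (∀ i, a i ≠ 0 → ∀ z z', semigroupHom a z = b → semigroupHom a z' = b → z i ≠ 0 →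
          z' i ≠ 0 → E z z') →
        ∀ z z', semigroupHom a z = b → semigroupHom a z' = b → E z z') := by
    intro b
    rcases eq_or_ne b 0 with rfl | hb
    · exact ⟨∅, by simp⟩
    · obtain ⟨R, h₁, h₂, h₃⟩ := exists_finset_connecting a hb
      exact ⟨R, h₁, h₂, fun _ => h₃⟩
  choose S hScard hSfib hS using hex
  have hSB : ∀ b ∉ B, S b = ∅ := fun b hb => by
    have h1 := hScard b
    have h2 : ¬ 2 ≤ numComp (FibreAdj a b) := fun h => hb (hB b h)
    exact Finset.card_eq_zero.1 (by omega)
  let Z : Finset ((ι → ℕ) × (ι → ℕ)) := {i | a i = 0}.toFinset.image fun i => (Pi.single i 1, 0)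
  refine ⟨Z ∪ B.biUnion S, fun z z' => ⟨fun h => ?_, fun h => ?_⟩, ?_⟩
  · refine AddCon.addConGen_le (c := AddCon.ker (semigroupHom a)).2 (fun x y hxy => ?_) h
    rw [AddCon.ker_rel]
    rcases Finset.mem_union.1 hxy with hxy | hxy
    · obtain ⟨i, hi, hxy⟩ := Finset.mem_image.1 hxy
      obtain ⟨rfl, rfl⟩ := Prod.ext_iff.1 hxy
      rw [semigroupHom_single, map_zero]
      simpa using hi
    · obtain ⟨b, -, hxy⟩ := Finset.mem_biUnion.1 hxy
      obtain ⟨h₁, h₂⟩ := hSfib b _ hxy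
      exact h₁.trans h₂.symm
  · set E := addConGen fun x y => (x, y) ∈ Z ∪ B.biUnion S with hEdef
    have hEZ : ∀ i, a i = 0 → E (Pi.single i 1) 0 := fun i hi =>
      AddConGen.Rel.of _ _ (Finset.mem_union_left _ (Finset.mem_image.2 ⟨i, by simp [hi], rfl⟩))
    have hES : ∀ b, ∀ x ∈ S b, E x.1 x.2 := by
      intro b x hx
      by_cases hb : b ∈ B
      · exact AddConGen.Rel.of _ _
          (Finset.mem_union_right _ (Finset.mem_biUnion.2 ⟨b, hb, hx⟩))
      · simp [hSB b hb] at hx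
    have hE0 : ∀ z, semigroupHom a z = 0 → E z 0 := fun z hz =>
      E.rel_zero_of_single z fun i hi => hEZ i (by
        by_contra hai
        exact hi (semigroupHom_eq_zero_iff.1 hz i hai))
    induction hN : ∑ j, semigroupHom a z j using Nat.strong_induction_on generalizing z z' with
    | _ N ih =>
      rcases eq_or_ne (semigroupHom a z) 0 with hz0 | hz0
      · exact E.trans (hE0 z hz0) (E.symm (hE0 z' (h ▸ hz0)))
      refine hS _ hz0 E (hES _) (fun i hai w w' hw hw' hwi hwi' => ?_) z z' rfl h.symm
      have hsub : ∀ w : ι → ℕ, w i ≠ 0 → ∃ y, w = Pi.single i 1 + y := fun w hw =>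
        exists_add_of_le (a := (Pi.single i 1 : ι → ℕ)) fun l => by
          rcases eq_or_ne l i with rfl | hl
          · simpa using Nat.one_le_iff_ne_zero.2 hw
          · simp [hl]
      obtain ⟨y, rfl⟩ := hsub w hwi
      obtain ⟨y', rfl⟩ := hsub w' hwi'
      rw [map_add, semigroupHom_single] at hw hw'
      refine E.add (E.refl _) (ih _ ?_ y y' (add_left_cancel (hw.trans hw'.symm)) rfl)
      rw [← hN, ← hw]
      simp only [Pi.add_apply, Finset.sum_add_distrib]
      have : 0 < ∑ j, a i j := by
        rw [Nat.pos_iff_ne_zero]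
        intro h0
        rw [Finset.sum_eq_zero_iff] at h0
        exact hai (funext fun j => h0 j (Finset.mem_univ j))
      omega
  · refine (Finset.card_union_le _ _).trans (add_le_add ?_ ?_)
    · rw [Set.ncard_eq_toFinset_card']
      exact Finset.card_image_le
    · exact Finset.card_biUnion_le.trans (Finset.sum_le_sum fun b _ => hScard b)

/-- The minimal size of a presentation, in terms of the graphs of the elements of `B`. -/
theorem sInf_card_isPresentation [Fintype μ] (a : ι → μ → ℕ) (B : Finset (μ → ℕ))
    (hB : ∀ b, 2 ≤ numComp (FibreAdj a b) → b ∈ B) :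
    sInf {r | ∃ R : Finset ((ι → ℕ) × (ι → ℕ)), R.card = r ∧ IsPresentation a R} =
      {i | a i = 0}.ncard + ∑ b ∈ B, (numComp (FibreAdj a b) - 1) := by
  obtain ⟨R, hR, hcard⟩ := exists_isPresentation_card_le a B hB
  refine le_antisymm (le_trans (Nat.sInf_le ?_) hcard) ?_
  · exact ⟨R, rfl, hR⟩
  refine le_csInf ⟨_, R, rfl, hR⟩ ?_
  rintro _ ⟨R', rfl, hR'⟩
  exact hR'.le_card B

end FibreGraph

section DigitExpansion

theorem sum_digits_lt {n r : ℕ} {f : Fin r → ℕ} (hf : ∀ l, f l < n) :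
    ∑ l, f l * n ^ (l : ℕ) < n ^ r := by
  have := (finFunctionFinEquiv fun l => (⟨f l, hf l⟩ : Fin n)).2
  rwa [finFunctionFinEquiv_apply] at this

theorem exists_sum_digits_eq {n r v : ℕ} (hv : v < n ^ r) :
    ∃ f : Fin r → ℕ, (∀ l, f l < n) ∧ ∑ l, f l * n ^ (l : ℕ) = v := by
  refine ⟨fun l => finFunctionFinEquiv.symm (⟨v, hv⟩ : Fin (n ^ r)) l, fun l => Fin.is_lt _, ?_⟩
  rw [← finFunctionFinEquiv_apply, Equiv.apply_symm_apply]

theorem eq_of_sum_digits_eq {n r : ℕ} {f g : Fin r → ℕ} (hf : ∀ l, f l < n) (hg : ∀ l, g l < n)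
    (h : ∑ l, f l * n ^ (l : ℕ) = ∑ l, g l * n ^ (l : ℕ)) : f = g := by
  have h' : finFunctionFinEquiv (fun l => (⟨f l, hf l⟩ : Fin n)) =
      finFunctionFinEquiv (fun l => (⟨g l, hg l⟩ : Fin n)) := by
    apply Fin.ext
    rw [finFunctionFinEquiv_apply, finFunctionFinEquiv_apply]
    exact h
  ext l
  simpa using congrFun (finFunctionFinEquiv.injective h') l

theorem sum_digits_ne_zero_iff {n r : ℕ} (hn : 1 ≤ n) {f : Fin r → ℕ} :
    ∑ l, f l * n ^ (l : ℕ) ≠ 0 ↔ ∃ l, f l ≠ 0 := by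
  have : n ≠ 0 := by omega
  simp [this]

variable {ι μ : Type*} [Fintype ι]

theorem exists_factorization_lt {a : ι → μ → ℕ} {z : ι → ℕ} {M : ℕ} (hM : 1 ≤ M)
    (hz : ∀ j, semigroupHom a z j < M) :
    ∃ z', semigroupHom a z' = semigroupHom a z ∧ (∀ i, z' i < M) ∧ ∀ i, a i ≠ 0 → z' i = z i := by
  classical
  refine ⟨fun i => if a i = 0 then 0 else z i, ?_, fun i => ?_, fun i hi => by simp [hi]⟩
  · rw [semigroupHom_apply, semigroupHom_apply]
    refine Finset.sum_congr rfl fun i _ => ?_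
    by_cases hi : a i = 0 <;> simp [hi]
  · by_cases hi : a i = 0
    · simp only [hi, if_true]
      omega
    · obtain ⟨j, hj⟩ := Function.ne_iff.1 hi
      simp only [hi, if_false]
      refine lt_of_le_of_lt ?_ (hz j)
      rw [semigroupHom_apply_apply]
      calc z i ≤ z i * a i j := Nat.le_mul_of_pos_right _ (Nat.pos_of_ne_zero hj)
        _ ≤ _ := Finset.single_le_sum (f := fun i => z i * a i j) (fun _ _ => Nat.zero_le _)
            (Finset.mem_univ i)

theorem fibreAdj_sum_digits_iff (a : ι → μ → ℕ) {n r : ℕ} (hn : 1 ≤ n) {y : μ × Fin r → ℕ}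
    (hy : ∀ v, y v < n) (i₁ i₂ : ι) :
    FibreAdj a (fun j => ∑ l, y (j, l) * n ^ (l : ℕ)) i₁ i₂ ↔ a i₁ ≠ 0 ∧ a i₂ ≠ 0 ∧
      ∃ ζ : ι × Fin r → ℕ, (∀ v, ζ v < n) ∧
        (∀ j, ∑ i, (∑ l, ζ (i, l) * n ^ (l : ℕ)) * a i j = ∑ l, y (j, l) * n ^ (l : ℕ)) ∧
        (∃ l, ζ (i₁, l) ≠ 0) ∧ ∃ l, ζ (i₂, l) ≠ 0 := by
  refine and_congr_right fun h₁ => and_congr_right fun h₂ => ⟨?_, ?_⟩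
  · rintro ⟨z, hz, hz₁, hz₂⟩
    obtain ⟨z', hz', hlt, heq⟩ := exists_factorization_lt (a := a) (z := z) (M := n ^ r)
      (Nat.one_le_pow _ _ hn) fun j => by rw [hz]; exact sum_digits_lt fun l => hy (j, l)
    choose ζ hζ hζz using fun i => exists_sum_digits_eq (hlt i)
    refine ⟨fun v => ζ v.1 v.2, fun v => hζ v.1 v.2, fun j => ?_, ?_, ?_⟩
    · simp only [hζz]
      rw [← semigroupHom_apply_apply, hz', hz]
    · rw [← sum_digits_ne_zero_iff hn, hζz, heq _ h₁]
      exact hz₁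
    · rw [← sum_digits_ne_zero_iff hn, hζz, heq _ h₂]
      exact hz₂
  · rintro ⟨ζ, -, hζ, hζ₁, hζ₂⟩
    refine ⟨fun i => ∑ l, ζ (i, l) * n ^ (l : ℕ), funext fun j => ?_,
      (sum_digits_ne_zero_iff hn).2 hζ₁, (sum_digits_ne_zero_iff hn).2 hζ₂⟩
    rw [semigroupHom_apply_apply, hζ]

theorem ncard_digitBox_fibre_eq (r n : ℕ) (hn : 1 ≤ n) (P : (μ → ℕ) → Prop) :
    {x ∈ {x ∈ digitBox (μ × Fin r) | P fun j => ∑ l, x (some (j, l)) * x none ^ (l : ℕ)} |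
      x none = n}.ncard = {b : μ → ℕ | (∀ j, b j < n ^ r) ∧ P b}.ncard := by
  rw [← Set.InjOn.ncard_image
    (f := fun x : Option (μ × Fin r) → ℕ => fun j => ∑ l, x (some (j, l)) * x none ^ (l : ℕ))]
  · congr 1
    ext b
    constructor
    · rintro ⟨x, ⟨⟨⟨-, hx⟩, hP⟩, rfl⟩, rfl⟩
      exact ⟨fun j => sum_digits_lt fun l => hx (j, l), hP⟩
    · rintro ⟨hb, hP⟩
      choose f hf hfb using fun j => exists_sum_digits_eq (hb j)
      have hval : (fun j => ∑ l, f j l * n ^ (l : ℕ)) = b := funext hfb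
      refine ⟨fun o => o.elim n fun v => f v.1 v.2, ⟨⟨⟨hn, fun v => hf v.1 v.2⟩, ?_⟩, rfl⟩, hval⟩
      simpa only [Option.elim, hval] using hP
  · rintro x ⟨⟨⟨-, hx⟩, -⟩, rfl⟩ x' ⟨⟨⟨-, hx'⟩, -⟩, hn'⟩ h
    funext o
    rcases o with _ | ⟨j, l⟩
    · exact hn'.symm
    · refine congrFun (eq_of_sum_digits_eq (g := fun l => x' (some (j, l)))
        (fun l => hx (j, l)) (fun l => ?_) ?_) l
      · rw [← hn']
        exact hx' (j, l)
      · have := congrFun h j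
        simp only [hn'] at this
        exact this

/-- The number of small elements with a prescribed graph. -/
theorem isClasswisePoly_ncard_fibreAdj_eq [Fintype μ] (F : ι → ℕ → μ → ℕ)
    (hF : ∀ i j, ∃ p : Polynomial ℤ, ∀ n : ℕ, ((F i n j : ℤ) = p.eval (n : ℤ)))
    (hF0 : ∀ᶠ n in atTop, ∀ i, F i n = 0 → ∀ n', F i n' = 0) (r : ℕ) (τ : ι → ι → Prop) :
    IsClasswisePoly fun n =>
      ({b : μ → ℕ | (∀ j, b j < n ^ r) ∧ FibreAdj (fun i => F i n) b = τ}.ncard : ℤ) := by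
  classical
  let D : ι → ι → Set (Option (μ × Fin r) → ℕ) := fun i₁ i₂ =>
    if (∀ n, F i₁ n = 0) ∨ ∀ n, F i₂ n = 0 then ∅ else
    {x ∈ digitBox (μ × Fin r) | ∃ ζ : ι × Fin r → ℕ, (∀ v, ζ v < x none) ∧
      (∀ j, ∑ i, (∑ l, ζ (i, l) * x none ^ (l : ℕ)) * F i (x none) j =
        ∑ l, x (some (j, l)) * x none ^ (l : ℕ)) ∧
      (∃ l, ζ (i₁, l) ≠ 0) ∧ ∃ l, ζ (i₂, l) ≠ 0}
  have hD : ∀ i₁ i₂, IsSemilinearSet (D i₁ i₂) := by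
    intro i₁ i₂
    by_cases h : (∀ n, F i₁ n = 0) ∨ ∀ n, F i₂ n = 0
    · simp only [D, h, if_true]
      exact .empty
    · simp only [D, h, if_false]
      exact isSemilinearSet_digit_fibre F hF r r i₁ i₂
  let X : Set (Option (μ × Fin r) → ℕ) :=
    digitBox (μ × Fin r) ∩ ⋂ i₁, ⋂ i₂, if τ i₁ i₂ then D i₁ i₂ else (D i₁ i₂)ᶜ
  have hX : IsSemilinearSet X := isSemilinearSet_digitBox.inter <| .iInter fun i₁ =>
    .iInter fun i₂ => by
      split_ifs
      exacts [hD i₁ i₂, (hD i₁ i₂).compl]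
  have hXbox : X ⊆ digitBox (μ × Fin r) := Set.inter_subset_left
  refine (hX.isClasswisePoly_ncard (w := Pi.evalAddMonoidHom (fun _ => ℕ) none)
    fun n => ?_).congr ?_
  · refine (Set.Finite.pi' (t := fun _ => Set.Iic n) fun _ => Set.finite_Iic n).subset ?_
    rintro x ⟨hx, rfl⟩ (_ | v)
    · exact le_refl (x none)
    · exact ((hXbox hx).2 v).le
  · filter_upwards [hF0, eventually_ge_atTop 1] with n hn0 hn1
    rw [← ncard_digitBox_fibre_eq r n hn1]
    congr 2
    ext x
    simp only [Set.mem_ofPred_eq, Pi.evalAddMonoidHom_apply]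
    refine and_congr_left fun hxn => ?_
    subst hxn
    refine and_congr_right fun hx => ?_
    simp only [Set.mem_iInter, funext_iff, eq_iff_iff]
    refine forall_congr' fun i₁ => forall_congr' fun i₂ => ?_
    have key : x ∈ D i₁ i₂ ↔ FibreAdj (fun i => F i (x none))
        (fun j => ∑ l, x (some (j, l)) * x none ^ (l : ℕ)) i₁ i₂ := by
      rw [fibreAdj_sum_digits_iff _ hx.1 (y := fun v => x (some v)) hx.2]
      by_cases h : (∀ n, F i₁ n = 0) ∨ ∀ n, F i₂ n = 0
      · simp only [D, h, if_true, Set.mem_empty_iff_false, false_iff]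
        rintro ⟨h₁, h₂, -⟩
        exact h.elim (fun h => h₁ (h _)) fun h => h₂ (h _)
      · simp only [D, h, if_false]
        rw [not_or] at h
        have h₁ : F i₁ (x none) ≠ 0 := fun h' => h.1 (hn0 _ h')
        have h₂ : F i₂ (x none) ≠ 0 := fun h' => h.2 (hn0 _ h')
        simp [h₁, h₂, hx]
    rw [← key]
    split_ifs with hτ <;> simp [hτ]

end DigitExpansion

section Growth

theorem Polynomial.exists_eventually_eval_le_pow (p : Polynomial ℤ) :
    ∃ d : ℕ, ∀ᶠ n : ℕ in atTop, p.eval (n : ℤ) ≤ (n : ℤ) ^ d := by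
  refine ⟨p.natDegree + 1, ?_⟩
  filter_upwards [eventually_ge_atTop 1,
    eventually_ge_atTop (∑ i ∈ Finset.range (p.natDegree + 1), (p.coeff i).natAbs)] with n hn hle
  rw [Polynomial.eval_eq_sum_range]
  calc ∑ i ∈ Finset.range (p.natDegree + 1), p.coeff i * (n : ℤ) ^ i
      ≤ ∑ i ∈ Finset.range (p.natDegree + 1), ((p.coeff i).natAbs : ℤ) * (n : ℤ) ^ p.natDegree := by
        refine Finset.sum_le_sum fun i hi => ?_
        have h1 : (1 : ℤ) ≤ n := by exact_mod_cast hn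
        gcongr
        · omega
        · simp at hi
          omega
    _ = ((∑ i ∈ Finset.range (p.natDegree + 1), (p.coeff i).natAbs : ℕ) : ℤ) *
          (n : ℤ) ^ p.natDegree := by rw [← Finset.sum_mul]; push_cast; rfl
    _ ≤ (n : ℤ) * (n : ℤ) ^ p.natDegree := by gcongr
    _ = (n : ℤ) ^ (p.natDegree + 1) := by ring

theorem Polynomial.eventually_eval_natCast_ne_zero {p : Polynomial ℤ} (hp : p ≠ 0) :
    ∀ᶠ n : ℕ in atTop, p.eval (n : ℤ) ≠ 0 := by
  rw [← Nat.cofinite_eq_atTop]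
  refine ((p.roots.toFinset.finite_toSet).preimage (Nat.cast_injective.injOn)).subset ?_
  intro n hn
  simpa [hp] using hn

variable {ι μ : Type*} [Finite ι] {F : ι → ℕ → μ → ℕ}

theorem eventually_forall_eq_zero_of_eq_zero
    (hF : ∀ i j, ∃ p : Polynomial ℤ, ∀ n : ℕ, ((F i n j : ℤ) = p.eval (n : ℤ))) :
    ∀ᶠ n in atTop, ∀ i, F i n = 0 → ∀ n', F i n' = 0 := by
  rw [eventually_all]
  intro i
  by_cases h : ∀ n', F i n' = 0
  · exact Eventually.of_forall fun _ _ => h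
  push Not at h
  obtain ⟨n', hn'⟩ := h
  obtain ⟨j, hj⟩ := Function.ne_iff.1 hn'
  obtain ⟨p, hp⟩ := hF i j
  have hp0 : p ≠ 0 := by
    rintro rfl
    have := hp n'
    simp at this
    exact hj this
  filter_upwards [Polynomial.eventually_eval_natCast_ne_zero hp0] with n hn h0
  rw [← hp, h0] at hn
  simp at hn

theorem exists_eventually_forall_le_pow [Finite μ]
    (hF : ∀ i j, ∃ p : Polynomial ℤ, ∀ n : ℕ, ((F i n j : ℤ) = p.eval (n : ℤ))) :
    ∃ d : ℕ, ∀ᶠ n in atTop, ∀ i j, F i n j ≤ n ^ d := by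
  choose p hp using hF
  choose d hd using fun i j => (p i j).exists_eventually_eval_le_pow
  obtain ⟨D, hD⟩ := (Set.finite_range fun v : ι × μ => d v.1 v.2).bddAbove
  refine ⟨D, ?_⟩
  filter_upwards [eventually_all.2 fun i => eventually_all.2 (hd i), eventually_ge_atTop 1]
    with n hn hn1 i j
  have h1 := hn i j
  rw [← hp] at h1
  exact (show F i n j ≤ n ^ d i j by exact_mod_cast h1).trans
    (Nat.pow_le_pow_right hn1 (hD ⟨(i, j), rfl⟩))

end Growth

theorem isClasswisePoly_sInf_card_isPresentation {ι μ : Type*} [Fintype ι] [Fintype μ]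
    (F : ι → ℕ → μ → ℕ)
    (hF : ∀ i j, ∃ p : Polynomial ℤ, ∀ n : ℕ, ((F i n j : ℤ) = p.eval (n : ℤ))) :
    IsClasswisePoly fun n => ((sInf {r : ℕ | ∃ R : Finset ((ι → ℕ) × (ι → ℕ)), R.card = r ∧
      IsPresentation (fun i => F i n) R} : ℕ) : ℤ) := by
  classical
  obtain ⟨d, hd⟩ := exists_eventually_forall_le_pow hF
  obtain ⟨e, he⟩ := exists_solutionBound_le_pow d (Fintype.card μ)
  have hF0 := eventually_forall_eq_zero_of_eq_zero hF
  let r := d + e + 1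
  refine ((IsClasswisePoly.const ({i | ∀ n, F i n = 0}.ncard : ℤ)).add
    (IsClasswisePoly.sum Finset.univ fun (τ : ι → ι → Prop) _ =>
      (isClasswisePoly_ncard_fibreAdj_eq F hF hF0 r τ).const_mul
        ((numComp τ - 1 : ℕ) : ℤ))).congr ?_
  filter_upwards [hd, hF0, eventually_ge_atTop 3] with n hdn hn0 hn3
  have hB : ∀ b : μ → ℕ, 2 ≤ numComp (FibreAdj (fun i => F i n) b) →
      b ∈ Fintype.piFinset fun _ : μ => Finset.range (n ^ r) := by
    intro b hb
    rw [Fintype.mem_piFinset]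
    intro j
    rw [Finset.mem_range]
    calc b j ≤ n ^ d * solutionBound (n ^ d) (Fintype.card μ) :=
          apply_le_of_two_le_numComp hdn hb j
      _ ≤ n ^ d * n ^ e := Nat.mul_le_mul_left _ (he n (n ^ d) hn3 le_rfl)
      _ = n ^ (d + e) := by ring
      _ < n ^ r := Nat.pow_lt_pow_right (by omega) (by omega)
  rw [sInf_card_isPresentation _ _ hB, ← Finset.sum_fiberwise _
    (fun b => FibreAdj (fun i => F i n) b)]
  push_cast
  refine congrArg₂ _ (congrArg (fun s : Set ι => (s.ncard : ℤ)) ?_) ?_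
  · ext i
    exact ⟨fun h => h n, fun h => hn0 i h⟩
  · refine Finset.sum_congr rfl fun τ _ => ?_
    rw [← Nat.cast_sum, Finset.sum_congr rfl (g := fun _ => numComp τ - 1) (fun b hb => by
      rw [(Finset.mem_filter.1 hb).2]), Finset.sum_const, smul_eq_mul, mul_comm, Nat.cast_mul,
      ← Set.ncard_coe_finset]
    congr 3
    ext b
    simp

theorem stmt12 (k m : ℕ) (hk : 1 ≤ k) (hm : 1 ≤ m)
    (F : Fin k → ℕ → Fin m → ℕ)
    (hF : ∀ i j, ∃ p : Polynomial ℤ, ∀ n : ℕ, ((F i n j : ℤ) = p.eval (n : ℤ))) :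
    IsEQP (fun n =>
      ((sInf {r : ℕ | ∃ R : Finset ((Fin k → ℕ) × (Fin k → ℕ)), R.card = r ∧
        ∀ z z' : Fin k → ℕ,
          addConGen (fun x y => (x, y) ∈ R) z z' ↔
            (∑ i, z i • F i n) = ∑ i, z' i • F i n} : ℕ) : ℤ)) := by
  exact (isClasswisePoly_sInf_card_isPresentation F hF).isEQP
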